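/- arXiv:0812.1968 — 2 statements merged into one kernel-verified Lean document; each statement's English description precedes it below -/
import Mathlib

section
/- Let A ⊆ ℤ with upper Banach density d*(A) = limsup_{N−M→∞} |A ∩ [M, N−1]| / (N−M) = δ. Then for all ε > 0, the set of pairs (n, m) ∈ ℤ² such that d*(A ∩ (A−n) ∩ (A−m) ∩ (A−n−m)) > δ⁴ − ε is syndetic in ℤ². -/
open MeasureTheory Filter

/-- A subset of `ℤ²` is syndetic if there is `L > 0` such that it meets every square
`[a, a+L) × [b, b+L)`. -/
def SyndeticZ2 (S : Set (ℤ × ℤ)) : Prop :=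
  ∃ L : ℤ, 0 < L ∧ ∀ a b : ℤ, ∃ n m : ℤ,
    a ≤ n ∧ n < a + L ∧ b ≤ m ∧ m < b + L ∧ (n, m) ∈ S

/-- The upper Banach density of a set `A ⊆ ℤ`:
`d*(A) = limsup_{N−M→∞} |A ∩ [M, N−1]| / (N−M)`, realized as the infimum over `L` of the
supremum of `|A ∩ [M,N)|/(N−M)` over all intervals `[M,N)` of length at least `L`. -/
noncomputable def upperBanachDensity (A : Set ℤ) : ℝ :=
  ⨅ L : ℕ, sSup {r : ℝ | ∃ M N : ℤ, (L : ℤ) ≤ N - M ∧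
    r = ((A ∩ Set.Ico M N).ncard : ℝ) / ((N : ℝ) - (M : ℝ))}

open Topology
open scoped BigOperators

/-- The limit of a real-valued function along an ultrafilter, meaningful for bounded functions. -/
noncomputable def ultraLim {ι : Type*} (V : Ultrafilter ι) (x : ι → ℝ) : ℝ :=
  limUnder (V : Filter ι) x

lemma tendsto_ultraLim {ι : Type*} (V : Ultrafilter ι) {x : ι → ℝ} {C : ℝ}
    (h : ∀ i, |x i| ≤ C) : Tendsto x V (𝓝 (ultraLim V x)) := by
  have hc : IsCompact (Set.Icc (-C) C) := isCompact_Icc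
  obtain ⟨y, -, hy⟩ := hc.ultrafilter_le_nhds (V.map x) (by
    rw [le_principal_iff, Ultrafilter.mem_coe, Ultrafilter.mem_map]
    exact Filter.univ_mem' fun i => abs_le.1 (h i))
  exact tendsto_nhds_limUnder ⟨y, hy⟩

lemma ultraLim_eq {ι : Type*} (V : Ultrafilter ι) {x : ι → ℝ} {a : ℝ}
    (h : Tendsto x V (𝓝 a)) : ultraLim V x = a := h.limUnder_eq

lemma abs_expect_le_of_abs_le {ι : Type*} {s : Finset ι} {x : ι → ℝ} {C : ℝ} (hC : 0 ≤ C)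
    (h : ∀ i, |x i| ≤ C) : |𝔼 i ∈ s, x i| ≤ C := by
  rcases s.eq_empty_or_nonempty with rfl | hs
  · simpa using hC
  · exact (Finset.abs_expect_le s x).trans (Finset.expect_le hs fun i _ => h i)

lemma abs_expect_sub_expect_le {ι : Type*} {s : Finset ι} {x y : ι → ℝ} {C : ℝ} (hC : 0 ≤ C)
    (h : ∀ i, |x i - y i| ≤ C) : |𝔼 i ∈ s, x i - 𝔼 i ∈ s, y i| ≤ C := by
  rw [← Finset.expect_sub_distrib]
  exact abs_expect_le_of_abs_le hC h

lemma sq_expect_le_expect_sq {ι : Type*} (s : Finset ι) (x : ι → ℝ) :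
    (𝔼 i ∈ s, x i) ^ 2 ≤ 𝔼 i ∈ s, x i ^ 2 := by
  rcases s.eq_empty_or_nonempty with rfl | hs
  · simp
  · simpa [Finset.expect_const hs] using Finset.expect_mul_sq_le_sq_mul_sq s x (fun _ => 1)

lemma abs_expect_Ico_add_one_sub_le {x : ℤ → ℝ} {C : ℝ} (h : ∀ i, |x i| ≤ C) {a b : ℤ}
    (hab : a < b) :
    |𝔼 n ∈ Finset.Ico a b, x (n + 1) - 𝔼 n ∈ Finset.Ico a b, x n| ≤ 2 * C / (b - a) := by
  have hsum : ∀ k : ℕ, ∑ n ∈ Finset.Ico a (a + k), (x (n + 1) - x n) = x (a + k) - x a := by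
    intro k
    induction k with
    | zero => simp
    | succ k ih =>
      have : Finset.Ico a (a + (k + 1 : ℕ)) = insert (a + k) (Finset.Ico a (a + k)) := by
        ext i; simp only [Finset.mem_Ico, Finset.mem_insert]; push_cast; omega
      rw [this, Finset.sum_insert (by simp), ih]
      push_cast
      rw [← add_assoc]
      ring
  have hba : (0 : ℝ) < b - a := by exact_mod_cast sub_pos.2 hab
  obtain ⟨k, rfl⟩ : ∃ k : ℕ, b = a + k := ⟨(b - a).toNat, by omega⟩
  rw [← Finset.expect_sub_distrib, Finset.expect_eq_sum_div_card, hsum, abs_div]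
  have hcard : (((Finset.Ico a (a + (k : ℤ))).card : ℕ) : ℝ) = ((a + k : ℤ) : ℝ) - a := by
    simp
  rw [hcard, abs_of_pos hba]
  gcongr
  have h1 := h (a + k)
  have h2 := h a
  rw [abs_le] at *
  constructor <;> linarith

lemma abs_expect_Ico_add_nat_sub_le {x : ℤ → ℝ} {C : ℝ} (h : ∀ i, |x i| ≤ C) {a b : ℤ}
    (hab : a < b) (k : ℕ) :
    |𝔼 n ∈ Finset.Ico a b, x (n + k) - 𝔼 n ∈ Finset.Ico a b, x n| ≤ k * (2 * C / (b - a)) := by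
  induction k with
  | zero => simp
  | succ k ih =>
    have h1 := abs_expect_Ico_add_one_sub_le (x := fun n => x (n + k)) (fun i => h _) hab
    have h2 : ∀ n : ℤ, n + ((k + 1 : ℕ) : ℤ) = n + 1 + k := fun n => by push_cast; ring
    simp_rw [h2]
    push_cast
    rw [abs_le] at *
    constructor <;> linarith

lemma abs_expect_Ico_add_sub_le {x : ℤ → ℝ} {C : ℝ} (h : ∀ i, |x i| ≤ C) {a b : ℤ}
    (hab : a < b) (k : ℤ) :
    |𝔼 n ∈ Finset.Ico a b, x (n + k) - 𝔼 n ∈ Finset.Ico a b, x n| ≤ |(k : ℝ)| * (2 * C / (b - a)) := by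
  obtain ⟨j, rfl | rfl⟩ := k.eq_nat_or_neg
  · simpa using abs_expect_Ico_add_nat_sub_le h hab j
  · have := abs_expect_Ico_add_nat_sub_le (x := fun n => x (n + -(j : ℤ))) (fun i => h _) hab j
    rw [abs_sub_comm]
    simpa using this

lemma tendsto_expect_Ico_add_sub {x : ℤ → ℝ} {C : ℝ} (h : ∀ i, |x i| ≤ C) (k : ℤ) {a b : ℕ → ℤ}
    (hab : Tendsto (fun N => b N - a N) atTop atTop) :
    Tendsto (fun N => 𝔼 n ∈ Finset.Ico (a N) (b N), x (n + k) - 𝔼 n ∈ Finset.Ico (a N) (b N), x n)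
      atTop (𝓝 0) := by
  have h1 : Tendsto (fun N => ((b N : ℝ) - a N)) atTop atTop := by
    have := (tendsto_intCast_atTop_atTop (R := ℝ)).comp hab
    simpa [Function.comp_def] using this
  have h2 : Tendsto (fun N => |(k : ℝ)| * (2 * C / ((b N : ℝ) - a N))) atTop (𝓝 0) := by
    simpa using ((tendsto_const_nhds (x := 2 * C)).div_atTop h1).const_mul |(k : ℝ)|
  refine squeeze_zero_norm' ?_ h2
  filter_upwards [hab.eventually_ge_atTop 1] with N hN
  exact abs_expect_Ico_add_sub_le h (by omega) k

section AlmostPeriodic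

open scoped RealInnerProductSpace

variable {H : Type*} [NormedAddCommGroup H] [InnerProductSpace ℝ H]

/-- The vectors whose orbit under a `ℤ`-indexed family of isometries is totally bounded. -/
def almostPeriodic (U : ℤ → H →ₗᵢ[ℝ] H) : Submodule ℝ H where
  carrier := {φ | TotallyBounded (Set.range fun n => U n φ)}
  zero_mem' := by
    simp
  add_mem' := by
    intro φ ψ hφ hψ
    rw [Set.mem_ofPred_eq, Metric.totallyBounded_iff] at *
    intro ε hε
    obtain ⟨s, hs, hs'⟩ := hφ (ε / 2) (half_pos hε)
    obtain ⟨t, ht, ht'⟩ := hψ (ε / 2) (half_pos hε)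
    refine ⟨Set.image2 (· + ·) s t, hs.image2 _ ht, ?_⟩
    rintro _ ⟨n, rfl⟩
    have h1 := hs' ⟨n, rfl⟩
    have h2 := ht' ⟨n, rfl⟩
    simp only [Set.mem_iUnion, exists_prop, Metric.mem_ball] at h1 h2 ⊢
    obtain ⟨y, hy, hy'⟩ := h1
    obtain ⟨z, hz, hz'⟩ := h2
    refine ⟨y + z, Set.mem_image2_of_mem hy hz, ?_⟩
    rw [map_add]
    exact (dist_add_add_le _ _ _ _).trans_lt (by linarith)
  smul_mem' := by
    intro c φ hφ
    refine (TotallyBounded.image hφ (uniformContinuous_const_smul c)).subset ?_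
    rintro _ ⟨n, rfl⟩
    exact ⟨U n φ, ⟨n, rfl⟩, by simp⟩

lemma mem_almostPeriodic {U : ℤ → H →ₗᵢ[ℝ] H} {φ : H} :
    φ ∈ almostPeriodic U ↔ TotallyBounded (Set.range fun n => U n φ) := Iff.rfl

lemma mem_almostPeriodic_of_forall_finite {U : ℤ → H →ₗᵢ[ℝ] H} {φ : H}
    (h : ∀ ε > 0, ∃ s : Set H, s.Finite ∧ ∀ n, ∃ y ∈ s, ‖U n φ - y‖ < ε) :
    φ ∈ almostPeriodic U := by
  rw [mem_almostPeriodic, Metric.totallyBounded_iff]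
  intro ε hε
  obtain ⟨s, hs, h⟩ := h ε hε
  refine ⟨s, hs, ?_⟩
  rintro _ ⟨n, rfl⟩
  obtain ⟨y, hy, hn⟩ := h n
  exact Set.mem_biUnion hy (by rwa [mem_ball_iff_norm])

lemma exists_finset_of_mem_almostPeriodic {U : ℤ → H →ₗᵢ[ℝ] H} {φ : H}
    (h : φ ∈ almostPeriodic U) {ε : ℝ} (hε : 0 < ε) :
    ∃ F : Finset ℤ, ∀ n, ∃ k ∈ F, ‖U n φ - U k φ‖ < ε := by
  classical
  obtain ⟨t, hts, ht, hcov⟩ := Metric.finite_approx_of_totallyBounded h ε hε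
  rw [← Set.image_univ] at hts
  obtain ⟨F, -, hF⟩ := (Set.exists_subset_image_finite_and
    (p := fun s => s.Finite ∧ t = s)).1 ⟨t, hts, ht, ht, rfl⟩
  obtain ⟨hFin, -, hF⟩ := hF
  refine ⟨hFin.toFinset, fun n => ?_⟩
  have := hcov ⟨n, rfl⟩
  simp only [hF, Set.mem_iUnion, Set.mem_image, exists_prop, exists_exists_and_eq_and] at this
  obtain ⟨k, hk, hn⟩ := this
  exact ⟨k, by simpa using hk, by rwa [mem_ball_iff_norm] at hn⟩

lemma isClosed_almostPeriodic (U : ℤ → H →ₗᵢ[ℝ] H) :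
    IsClosed (almostPeriodic U : Set H) := by
  rw [← closure_subset_iff_isClosed]
  intro φ hφ
  refine mem_almostPeriodic_of_forall_finite fun ε hε => ?_
  obtain ⟨ψ, hψ, hd⟩ := Metric.mem_closure_iff.1 hφ (ε / 2) (by positivity)
  obtain ⟨F, hF⟩ := exists_finset_of_mem_almostPeriodic hψ (half_pos hε)
  refine ⟨(fun k => U k ψ) '' F, F.finite_toSet.image _, fun n => ?_⟩
  obtain ⟨k, hk, hn⟩ := hF n
  refine ⟨_, ⟨k, hk, rfl⟩, ?_⟩
  calc ‖U n φ - U k ψ‖ = ‖U n (φ - ψ) + (U n ψ - U k ψ)‖ := by rw [map_sub]; abel_nf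
    _ ≤ ‖U n (φ - ψ)‖ + ‖U n ψ - U k ψ‖ := norm_add_le _ _
    _ < ε / 2 + ε / 2 := by
      rw [(U n).norm_map, ← dist_eq_norm]
      gcongr
    _ = ε := by ring

/-- The quadratic averages of the products `⟪φ, U n u⟫ * ⟪ψ, U n u⟫` along an ultrafilter. -/
noncomputable def recurrenceForm (U : ℤ → H →ₗᵢ[ℝ] H) (u : H) (V : Ultrafilter ℕ) (φ ψ : H) : ℝ :=
  ultraLim V fun N : ℕ => 𝔼 n ∈ Finset.Ico (0 : ℤ) N, ⟪φ, U n u⟫ * ⟪ψ, U n u⟫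

variable (U : ℤ → H →ₗᵢ[ℝ] H) (u : H) (V : Ultrafilter ℕ)

lemma abs_inner_mul_inner_le (φ ψ : H) (n : ℤ) :
    |⟪φ, U n u⟫ * ⟪ψ, U n u⟫| ≤ ‖u‖ ^ 2 * ‖φ‖ * ‖ψ‖ := by
  have h1 := abs_real_inner_le_norm φ (U n u)
  have h2 := abs_real_inner_le_norm ψ (U n u)
  rw [(U n).norm_map] at h1 h2
  rw [abs_mul]
  calc _ ≤ (‖φ‖ * ‖u‖) * (‖ψ‖ * ‖u‖) := by gcongr
    _ = _ := by ring

lemma tendsto_recurrenceForm (φ ψ : H) :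
    Tendsto (fun N : ℕ => 𝔼 n ∈ Finset.Ico (0 : ℤ) N, ⟪φ, U n u⟫ * ⟪ψ, U n u⟫) V
      (𝓝 (recurrenceForm U u V φ ψ)) :=
  tendsto_ultraLim V fun _ => abs_expect_le_of_abs_le (by positivity)
    (abs_inner_mul_inner_le U u φ ψ)

lemma recurrenceForm_comm (φ ψ : H) :
    recurrenceForm U u V φ ψ = recurrenceForm U u V ψ φ := by
  simp only [recurrenceForm, mul_comm]

lemma recurrenceForm_add_left (φ φ' ψ : H) :
    recurrenceForm U u V (φ + φ') ψ = recurrenceForm U u V φ ψ + recurrenceForm U u V φ' ψ := by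
  refine tendsto_nhds_unique (tendsto_recurrenceForm U u V _ _) ?_
  refine ((tendsto_recurrenceForm U u V φ ψ).add (tendsto_recurrenceForm U u V φ' ψ)).congr ?_
  intro N
  rw [← Finset.expect_add_distrib]
  simp only [inner_add_left, add_mul]

lemma recurrenceForm_smul_left (c : ℝ) (φ ψ : H) :
    recurrenceForm U u V (c • φ) ψ = c * recurrenceForm U u V φ ψ := by
  refine tendsto_nhds_unique (tendsto_recurrenceForm U u V _ _) ?_
  refine ((tendsto_recurrenceForm U u V φ ψ).const_mul c).congr ?_
  intro N
  rw [Finset.mul_expect]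
  simp only [real_inner_smul_left, mul_assoc]

lemma abs_recurrenceForm_le (φ ψ : H) :
    |recurrenceForm U u V φ ψ| ≤ ‖u‖ ^ 2 * ‖φ‖ * ‖ψ‖ :=
  le_of_tendsto (tendsto_recurrenceForm U u V φ ψ).abs (Eventually.of_forall fun _ =>
    abs_expect_le_of_abs_le (by positivity) (abs_inner_mul_inner_le U u φ ψ))

lemma recurrenceForm_self_nonneg (φ : H) : 0 ≤ recurrenceForm U u V φ φ :=
  ge_of_tendsto (tendsto_recurrenceForm U u V φ φ) (Eventually.of_forall fun _ =>
    Finset.expect_nonneg fun _ _ => mul_self_nonneg _)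

lemma recurrenceForm_sq_le (φ ψ : H) :
    recurrenceForm U u V φ ψ ^ 2 ≤ recurrenceForm U u V φ φ * recurrenceForm U u V ψ ψ := by
  refine le_of_tendsto_of_tendsto' ((tendsto_recurrenceForm U u V φ ψ).pow 2)
    ((tendsto_recurrenceForm U u V φ φ).mul (tendsto_recurrenceForm U u V ψ ψ)) fun N => ?_
  simpa only [sq] using Finset.expect_mul_sq_le_sq_mul_sq (Finset.Ico (0 : ℤ) N)
    (fun n => ⟪φ, U n u⟫) (fun n => ⟪ψ, U n u⟫)

lemma sum_recurrenceForm_le {ι : Type*} {v : ι → H} (hv : Orthonormal ℝ v) (s : Finset ι) :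
    ∑ i ∈ s, recurrenceForm U u V (v i) (v i) ≤ ‖u‖ ^ 2 := by
  refine le_of_tendsto (tendsto_finsetSum s fun i _ => tendsto_recurrenceForm U u V (v i) (v i))
    (Eventually.of_forall fun N => ?_)
  rw [← Finset.expect_sum_comm]
  refine (le_abs_self _).trans (abs_expect_le_of_abs_le (by positivity) fun n => ?_)
  have h := hv.sum_inner_products_le (s := s) (U n u)
  simp only [(U n).norm_map, Real.norm_eq_abs, sq_abs] at h
  rw [abs_of_nonneg (Finset.sum_nonneg fun _ _ => mul_self_nonneg _)]
  simpa only [sq] using h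

/-- Outside the orthogonal complement of a finite set, the recurrence form is small. -/
lemma exists_finset_recurrenceForm_lt {ε : ℝ} (hε : 0 < ε) :
    ∃ s : Finset H, ∀ y, ‖y‖ = 1 → (∀ x ∈ s, ⟪x, y⟫ = 0) → recurrenceForm U u V y y < ε := by
  by_contra! hcon
  obtain ⟨v, hv, hv'⟩ := exists_seq_of_forall_finset_exists
    (fun y : H => ‖y‖ = 1 ∧ ε ≤ recurrenceForm U u V y y) (fun x y => ⟪x, y⟫ = 0)
    (fun s _ => by
      obtain ⟨y, h1, h2, h3⟩ := hcon s
      exact ⟨y, ⟨h1, h3⟩, h2⟩)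
  have hon : Orthonormal ℝ v := by
    refine ⟨fun n => (hv n).1, fun m n hmn => ?_⟩
    rcases lt_or_gt_of_ne hmn with h | h
    · exact hv' m n h
    · rw [real_inner_comm]; exact hv' n m h
  obtain ⟨r, hr⟩ := exists_nat_gt (‖u‖ ^ 2 / ε)
  have h1 := sum_recurrenceForm_le U u V hon (Finset.range r)
  have h2 : ∑ _i ∈ Finset.range r, ε ≤ ∑ i ∈ Finset.range r, recurrenceForm U u V (v i) (v i) :=
    Finset.sum_le_sum fun i _ => (hv i).2
  rw [Finset.sum_const, Finset.card_range, nsmul_eq_mul] at h2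
  rw [div_lt_iff₀ hε] at hr
  linarith

lemma inner_apply_eq_inner_neg (hU0 : ∀ φ, U 0 φ = φ)
    (hU : ∀ a b φ, U (a + b) φ = U a (U b φ)) (k : ℤ) (φ ψ : H) : ⟪U k φ, ψ⟫ = ⟪φ, U (-k) ψ⟫ := by
  rw [← (U (-k)).inner_map_map, ← hU, neg_add_cancel, hU0]

lemma recurrenceForm_apply_left (hU0 : ∀ φ, U 0 φ = φ)
    (hU : ∀ a b φ, U (a + b) φ = U a (U b φ)) {V : Ultrafilter ℕ} (hV : (V : Filter ℕ) ≤ atTop) (k : ℤ)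
    (φ ψ : H) : recurrenceForm U u V (U k φ) ψ = recurrenceForm U u V φ (U (-k) ψ) := by
  have h1 := (tendsto_expect_Ico_add_sub (abs_inner_mul_inner_le U u φ (U (-k) ψ)) (-k)
    (a := fun _ => 0) (b := fun N => (N : ℤ)) (by simpa using tendsto_natCast_atTop_atTop)).mono_left hV
  have h2 := (tendsto_recurrenceForm U u V (U k φ) ψ).sub
    (tendsto_recurrenceForm U u V φ (U (-k) ψ))
  refine sub_eq_zero.1 (tendsto_nhds_unique h2 (h1.congr fun N => ?_))
  congr 1
  refine Finset.expect_congr rfl fun n _ => ?_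
  rw [inner_apply_eq_inner_neg U hU0 hU k φ, ← hU, inner_apply_eq_inner_neg U hU0 hU (-k) ψ,
    ← hU, neg_neg, add_comm (-k) n]
  congr 3
  ring_nf

variable [CompleteSpace H]

/-- The self-adjoint operator representing `recurrenceForm`. -/
noncomputable def recurrenceOperator : H →L[ℝ] H :=
  InnerProductSpace.continuousLinearMapOfBilin (𝕜 := ℝ) <|
    (LinearMap.mk₂ ℝ (recurrenceForm U u V) (recurrenceForm_add_left U u V)
      (recurrenceForm_smul_left U u V)
      (fun φ ψ ψ' => by
        rw [recurrenceForm_comm, recurrenceForm_add_left, recurrenceForm_comm,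
          recurrenceForm_comm U u V ψ'])
      (fun c φ ψ => by
        rw [recurrenceForm_comm, recurrenceForm_smul_left, recurrenceForm_comm]
        rfl)).mkContinuous₂ (‖u‖ ^ 2) (abs_recurrenceForm_le U u V)

lemma inner_recurrenceOperator (φ ψ : H) :
    ⟪recurrenceOperator U u V φ, ψ⟫ = recurrenceForm U u V φ ψ := by
  unfold recurrenceOperator
  rw [InnerProductSpace.continuousLinearMapOfBilin_apply]
  rfl

lemma norm_recurrenceOperator_sq_le (φ : H) :
    ‖recurrenceOperator U u V φ‖ ^ 2 ≤ ‖u‖ ^ 2 * recurrenceForm U u V φ φ := by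
  set κ := recurrenceOperator U u V φ with hκ
  rcases eq_or_ne κ 0 with h0 | h0
  · rw [h0]
    simpa using mul_nonneg (sq_nonneg ‖u‖) (recurrenceForm_self_nonneg U u V φ)
  have h1 : ‖κ‖ ^ 2 = recurrenceForm U u V φ κ := by
    rw [← inner_recurrenceOperator, ← hκ, real_inner_self_eq_norm_sq]
  have h2 := recurrenceForm_sq_le U u V φ κ
  have h3 := (le_abs_self _).trans (abs_recurrenceForm_le U u V κ κ)
  have h4 := recurrenceForm_self_nonneg U u V φ
  have hpos : 0 < ‖κ‖ ^ 2 := by positivity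
  rw [← h1] at h2
  have h5 : ‖κ‖ ^ 2 * ‖κ‖ ^ 2 ≤ (‖u‖ ^ 2 * recurrenceForm U u V φ φ) * ‖κ‖ ^ 2 := by nlinarith
  exact le_of_mul_le_mul_right h5 hpos

lemma totallyBounded_image_recurrenceOperator {S : Set H} {R : ℝ} (hS : ∀ x ∈ S, ‖x‖ ≤ R) :
    TotallyBounded (recurrenceOperator U u V '' S) := by
  rcases S.eq_empty_or_nonempty with rfl | ⟨x₀, hx₀⟩
  · simp
  have hR : 0 ≤ R := (norm_nonneg _).trans (hS _ hx₀)
  rw [Metric.totallyBounded_iff]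
  intro ε hε
  obtain ⟨η, hη, hη'⟩ : ∃ η > 0, ‖u‖ ^ 2 * (η * R ^ 2) < (ε / 2) ^ 2 := by
    refine ⟨(ε / 2) ^ 2 / (‖u‖ ^ 2 * R ^ 2 + 1), by positivity, ?_⟩
    rw [div_mul_eq_mul_div, mul_div_assoc', div_lt_iff₀ (by positivity)]
    have : 0 < (ε / 2) ^ 2 := by positivity
    nlinarith
  obtain ⟨s, hs⟩ := exists_finset_recurrenceForm_lt U u V hη
  let W : Submodule ℝ H := Submodule.span ℝ (s : Set H)
  have hsmall : ∀ y ∈ Wᗮ, ‖y‖ ≤ R → ‖recurrenceOperator U u V y‖ < ε / 2 := by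
    intro y hy hyR
    rcases eq_or_ne y 0 with rfl | hy0
    · simpa using hε
    have hn : 0 < ‖y‖ := norm_pos_iff.2 hy0
    have h1 := hs (‖y‖⁻¹ • y) (by rw [norm_smul]; simp [hn.ne']) (fun x hx => by
      rw [real_inner_smul_right, (Submodule.mem_orthogonal W y).1 hy x (Submodule.subset_span hx),
        mul_zero])
    rw [recurrenceForm_smul_left, recurrenceForm_comm, recurrenceForm_smul_left,
      ← mul_assoc, ← mul_inv, inv_mul_lt_iff₀ (by positivity)] at h1
    have h2 := norm_recurrenceOperator_sq_le U u V y
    refine lt_of_pow_lt_pow_left₀ 2 (by positivity) (h2.trans_lt (lt_of_le_of_lt ?_ hη'))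
    have : ‖y‖ * ‖y‖ * η ≤ η * R ^ 2 := by
      rw [mul_comm, ← sq]; gcongr
    gcongr
    linarith
  have hfin : FiniteDimensional ℝ W := inferInstance
  have hcomp : IsCompact (recurrenceOperator U u V '' (W.subtypeL '' Metric.closedBall 0 R)) :=
    ((ProperSpace.isCompact_closedBall (0 : W) R).image W.subtypeL.continuous).image
      (recurrenceOperator U u V).continuous
  obtain ⟨t, ht, hcov⟩ := Metric.totallyBounded_iff.1 hcomp.totallyBounded (ε / 2) (half_pos hε)
  refine ⟨t, ht, ?_⟩
  rintro _ ⟨x, hx, rfl⟩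
  have hw : x - W.starProjection x ∈ Wᗮ := W.sub_starProjection_mem_orthogonal x
  have hpyth : ‖x‖ ^ 2 = ‖W.starProjection x‖ ^ 2 + ‖x - W.starProjection x‖ ^ 2 := by
    have h := norm_add_sq_eq_norm_sq_add_norm_sq_of_inner_eq_zero (W.starProjection x)
      (x - W.starProjection x) ((Submodule.mem_orthogonal W _).1 hw _
        (W.starProjection_apply_mem x))
    simpa only [add_sub_cancel, ← sq] using h
  have hxR := hS x hx
  have hp : ‖W.starProjection x‖ ≤ R :=
    (le_of_sq_le_sq (by nlinarith [sq_nonneg ‖x - W.starProjection x‖]) (norm_nonneg _)).trans hxR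
  have hq : ‖x - W.starProjection x‖ ≤ R :=
    (le_of_sq_le_sq (by nlinarith [sq_nonneg ‖W.starProjection x‖]) (norm_nonneg _)).trans hxR
  have hmem := hcov ⟨W.starProjection x, ⟨⟨_, W.starProjection_apply_mem x⟩, by simpa using hp,
    rfl⟩, rfl⟩
  simp only [Set.mem_iUnion, exists_prop] at hmem ⊢
  obtain ⟨y, hy, hyb⟩ := hmem
  refine ⟨y, hy, ?_⟩
  rw [mem_ball_iff_norm] at hyb ⊢
  have h3 := hsmall _ hw hq
  calc ‖recurrenceOperator U u V x - y‖
      = ‖recurrenceOperator U u V (x - W.starProjection x)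
          + (recurrenceOperator U u V (W.starProjection x) - y)‖ := by
        rw [map_sub]; abel_nf
    _ ≤ _ := norm_add_le _ _
    _ < ε / 2 + ε / 2 := add_lt_add h3 hyb
    _ = ε := by ring

lemma recurrenceOperator_mem_almostPeriodic (hU0 : ∀ φ, U 0 φ = φ)
    (hU : ∀ a b φ, U (a + b) φ = U a (U b φ)) {V : Ultrafilter ℕ} (hV : (V : Filter ℕ) ≤ atTop)
    (φ : H) : recurrenceOperator U u V φ ∈ almostPeriodic U := by
  rw [mem_almostPeriodic]
  refine (totallyBounded_image_recurrenceOperator U u V (S := Set.range fun n => U n φ)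
    (R := ‖φ‖) (by rintro _ ⟨n, rfl⟩; simp)).subset ?_
  rintro _ ⟨n, rfl⟩
  refine ⟨_, ⟨n, rfl⟩, ext_inner_right ℝ fun ψ => ?_⟩
  rw [inner_recurrenceOperator, recurrenceForm_apply_left U u hU0 hU hV,
    ← inner_recurrenceOperator, ← inner_apply_eq_inner_neg U hU0 hU]

/-- A vector orthogonal to the almost periodic vectors is weakly mixing. -/
theorem tendsto_expect_inner_sq_of_mem_orthogonal (hU0 : ∀ φ, U 0 φ = φ)
    (hU : ∀ a b φ, U (a + b) φ = U a (U b φ)) (hu : u ∈ (almostPeriodic U)ᗮ) :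
    Tendsto (fun N : ℕ => 𝔼 n ∈ Finset.Ico (0 : ℤ) N, ⟪u, U n u⟫ ^ 2) atTop (𝓝 0) := by
  rw [tendsto_iff_ultrafilter]
  intro V hV
  suffices h : recurrenceForm U u V u u = 0 by
    simpa only [h, ← sq] using tendsto_recurrenceForm U u V u u
  rw [← inner_recurrenceOperator]
  exact (Submodule.mem_orthogonal _ u).1 hu _
    (recurrenceOperator_mem_almostPeriodic U u hU0 hU hV u)

end AlmostPeriodic

section MeasureFlow

variable {X : Type*} [MeasurableSpace X]

/-- A measure-preserving `ℤ`-action by `τ` whose correlations average to products of integrals,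
uniformly over long intervals. -/
structure IsErgodicFlow (μ : Measure X) (τ : ℤ → X → X) : Prop where
  measurePreserving : ∀ n, MeasurePreserving (τ n) μ μ
  add_apply : ∀ a b x, τ (a + b) x = τ a (τ b x)
  zero_apply : ∀ x, τ 0 x = x
  exists_abs_expect_sub_le : ∀ g h : X → ℝ, Measurable g → Measurable h → (∀ x, |g x| ≤ 1) →
    (∀ x, |h x| ≤ 1) → ∀ ε > 0, ∃ L : ℕ, ∀ a b : ℤ, a + L ≤ b →
      |𝔼 n ∈ Finset.Ico a b, ∫ x, g x * h (τ n x) ∂μ - (∫ x, g x ∂μ) * ∫ x, h x ∂μ| ≤ ε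

lemma integrable_of_abs_le {μ : Measure X} [IsFiniteMeasure μ] {φ : X → ℝ} (hφ : Measurable φ)
    {C : ℝ} (h : ∀ x, |φ x| ≤ C) : Integrable φ μ :=
  Integrable.of_bound hφ.aestronglyMeasurable C (Eventually.of_forall h)

lemma abs_integral_mul_sub_integral_mul_le {μ : Measure X} [IsFiniteMeasure μ]
    {g g' h : X → ℝ} (hg : Integrable g μ) (hg' : Integrable g' μ) (hh : Measurable h) {C : ℝ}
    (bh : ∀ x, |h x| ≤ C) {η : ℝ} (hη : ∫ x, |g x - g' x| ∂μ ≤ η) (hC : 0 ≤ C) :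
    |∫ x, g x * h x ∂μ - ∫ x, g' x * h x ∂μ| ≤ C * η := by
  have hi : ∀ {φ : X → ℝ}, Integrable φ μ → Integrable (fun x => φ x * h x) μ := fun hφ =>
    hφ.mul_bdd (c := C) hh.aestronglyMeasurable (Eventually.of_forall bh)
  rw [← integral_sub (hi hg) (hi hg')]
  refine abs_integral_le_integral_abs.trans ?_
  calc _ ≤ ∫ x, C * |g x - g' x| ∂μ := by
        refine integral_mono ((hi hg).sub (hi hg')).abs ((hg.sub hg').abs.const_mul C) fun x => ?_
        change |g x * h x - g' x * h x| ≤ _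
        rw [← sub_mul, abs_mul, mul_comm]
        exact mul_le_mul_of_nonneg_right (bh x) (abs_nonneg _)
    _ ≤ _ := by
        rw [integral_const_mul]
        exact mul_le_mul_of_nonneg_left hη hC

lemma sq_integral_le_integral_sq {μ : Measure X} [IsProbabilityMeasure μ] {φ : X → ℝ}
    (h1 : Integrable φ μ) (h2 : Integrable (fun x => φ x ^ 2) μ) :
    (∫ x, φ x ∂μ) ^ 2 ≤ ∫ x, φ x ^ 2 ∂μ := by
  set c := ∫ x, φ x ∂μ with hc
  have h : 0 ≤ ∫ x, (φ x - c) ^ 2 ∂μ := integral_nonneg fun x => sq_nonneg _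
  have h3 : ∀ x, (φ x - c) ^ 2 = φ x ^ 2 - 2 * c * φ x + c ^ 2 := fun x => by ring
  have h4 : Integrable (fun x => φ x ^ 2 - 2 * c * φ x) μ := h2.sub (h1.const_mul _)
  simp_rw [h3] at h
  rw [integral_add h4 (integrable_const _), integral_sub h2 (h1.const_mul _),
    integral_const_mul, ← hc] at h
  simp only [integral_const, probReal_univ, smul_eq_mul, one_mul] at h
  linarith

/-- Truncation of a real number to the unit interval. -/
def unitClamp (t : ℝ) : ℝ := max 0 (min t 1)

lemma lipschitzWith_unitClamp : LipschitzWith 1 unitClamp :=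
  (LipschitzWith.id.min_const 1).const_max 0

lemma unitClamp_zero : unitClamp 0 = 0 := by simp [unitClamp]

lemma unitClamp_of_mem {t : ℝ} (h0 : 0 ≤ t) (h1 : t ≤ 1) : unitClamp t = t := by
  simp [unitClamp, h0, h1]

lemma unitClamp_nonneg (t : ℝ) : 0 ≤ unitClamp t := le_max_left _ _

lemma unitClamp_le_one (t : ℝ) : unitClamp t ≤ 1 := by simp [unitClamp]

variable {μ : Measure X} {τ : ℤ → X → X}

/-- The isometries of `L²` induced by a measure-preserving family. -/
noncomputable def koopman (hτ : ∀ n, MeasurePreserving (τ n) μ μ) (n : ℤ) :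
    Lp ℝ 2 μ →ₗᵢ[ℝ] Lp ℝ 2 μ :=
  Lp.compMeasurePreservingₗᵢ ℝ (τ n) (hτ n)

lemma coeFn_koopman (hτ : ∀ n, MeasurePreserving (τ n) μ μ) (n : ℤ) (φ : Lp ℝ 2 μ) :
    koopman hτ n φ =ᵐ[μ] fun x => φ (τ n x) :=
  Lp.coeFn_compMeasurePreserving φ (hτ n)

lemma koopman_zero (hτ : ∀ n, MeasurePreserving (τ n) μ μ) (h0 : ∀ x, τ 0 x = x)
    (φ : Lp ℝ 2 μ) : koopman hτ 0 φ = φ := by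
  ext1
  filter_upwards [coeFn_koopman hτ 0 φ] with x hx
  rw [hx, h0]

lemma koopman_add (hτ : ∀ n, MeasurePreserving (τ n) μ μ)
    (hadd : ∀ a b x, τ (a + b) x = τ a (τ b x)) (a b : ℤ) (φ : Lp ℝ 2 μ) :
    koopman hτ (a + b) φ = koopman hτ a (koopman hτ b φ) := by
  ext1
  have h := (hτ a).quasiMeasurePreserving.ae_eq_comp (coeFn_koopman hτ b φ)
  filter_upwards [coeFn_koopman hτ (a + b) φ, coeFn_koopman hτ a (koopman hτ b φ), h]
    with x h1 h2 h3
  rw [h1, h2, add_comm, hadd]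
  exact h3.symm

lemma koopman_compLp (hτ : ∀ n, MeasurePreserving (τ n) μ μ) (n : ℤ) (φ : Lp ℝ 2 μ) :
    koopman hτ n (lipschitzWith_unitClamp.compLp unitClamp_zero φ) =
      lipschitzWith_unitClamp.compLp unitClamp_zero (koopman hτ n φ) := by
  ext1
  have h := (hτ n).quasiMeasurePreserving.ae_eq_comp
    (lipschitzWith_unitClamp.coeFn_compLp unitClamp_zero φ)
  filter_upwards [coeFn_koopman hτ n (lipschitzWith_unitClamp.compLp unitClamp_zero φ),
    lipschitzWith_unitClamp.coeFn_compLp unitClamp_zero (koopman hτ n φ), coeFn_koopman hτ n φ, h]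
    with x h1 h2 h3 h4
  rw [h1, h2, Function.comp_apply, h3]
  exact h4

lemma compLp_mem_almostPeriodic (hτ : ∀ n, MeasurePreserving (τ n) μ μ) {φ : Lp ℝ 2 μ}
    (hφ : φ ∈ almostPeriodic (koopman hτ)) :
    lipschitzWith_unitClamp.compLp unitClamp_zero φ ∈ almostPeriodic (koopman hτ) := by
  rw [mem_almostPeriodic] at hφ ⊢
  refine (hφ.image (lipschitzWith_unitClamp.lipschitzWith_compLp unitClamp_zero
    (p := 2)).uniformContinuous).subset ?_
  rintro _ ⟨n, rfl⟩
  exact ⟨_, ⟨n, rfl⟩, (koopman_compLp hτ n φ).symm⟩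

open scoped RealInnerProductSpace in
lemma integral_abs_le_norm [IsProbabilityMeasure μ] (φ : Lp ℝ 2 μ) : ∫ x, |φ x| ∂μ ≤ ‖φ‖ := by
  have h1 : Integrable φ μ := (Lp.memLp φ).integrable (by norm_num)
  have h2 : Integrable (fun x => |φ x| ^ 2) μ := by
    simpa using (Lp.memLp φ).integrable_sq
  refine le_of_sq_le_sq ((sq_integral_le_integral_sq h1.abs h2).trans_eq ?_) (norm_nonneg _)
  rw [← real_inner_self_eq_norm_sq, L2.inner_def]
  refine integral_congr_ae (Eventually.of_forall fun x => ?_)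
  simp [sq]

open scoped RealInnerProductSpace in
/-- The decomposition of a bounded function into an almost periodic and a weakly mixing part. -/
theorem exists_almostPeriodic_decomposition [IsProbabilityMeasure μ] (hτ : IsErgodicFlow μ τ)
    {f : X → ℝ} (hf : Measurable f) (hf0 : ∀ x, 0 ≤ f x) (hf1 : ∀ x, f x ≤ 1) :
    ∃ g : X → ℝ, Measurable g ∧ (∀ x, 0 ≤ g x) ∧ (∀ x, g x ≤ 1) ∧
      ∫ x, g x ∂μ = ∫ x, f x ∂μ ∧
      (∀ ε > 0, ∃ F : Finset ℤ, ∀ n, ∃ k ∈ F, ∫ x, |g (τ n x) - g (τ k x)| ∂μ ≤ ε) ∧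
      Tendsto (fun N : ℕ => 𝔼 n ∈ Finset.Ico (0 : ℤ) N,
        (∫ x, (f x - g x) * (f (τ n x) - g (τ n x)) ∂μ) ^ 2) atTop (𝓝 0) := by
  have hmp := hτ.measurePreserving
  let W := almostPeriodic (koopman hmp)
  have : CompleteSpace W := (isClosed_almostPeriodic (koopman hmp)).completeSpace_coe
  have hfL : MemLp f 2 μ := MemLp.of_bound hf.aestronglyMeasurable 1
    (Eventually.of_forall fun x => by rw [Real.norm_eq_abs, abs_of_nonneg (hf0 x)]; exact hf1 x)
  set F : Lp ℝ 2 μ := hfL.toLp f with hF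
  have hFf : F =ᵐ[μ] f := hfL.coeFn_toLp
  set p : Lp ℝ 2 μ := W.starProjection F with hp
  have hpW : p ∈ W := W.starProjection_apply_mem F
  have hort : F - p ∈ Wᗮ := W.sub_starProjection_mem_orthogonal F
  set q := lipschitzWith_unitClamp.compLp unitClamp_zero p with hq
  have hqW : q ∈ W := compLp_mem_almostPeriodic hmp hpW
  have hFF : lipschitzWith_unitClamp.compLp unitClamp_zero F = F := by
    ext1
    filter_upwards [lipschitzWith_unitClamp.coeFn_compLp unitClamp_zero F, hFf] with x h1 h2
    rw [h1, Function.comp_apply, h2, unitClamp_of_mem (hf0 x) (hf1 x)]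
  have hle : ‖F - q‖ ≤ ‖F - p‖ := by
    have := lipschitzWith_unitClamp.norm_compLp_sub_le unitClamp_zero F p
    rwa [hFF, NNReal.coe_one, one_mul] at this
  have hpq : p = q := by
    have h := norm_add_sq_eq_norm_sq_add_norm_sq_of_inner_eq_zero (F - p) (p - q)
      ((Submodule.mem_orthogonal' W _).1 hort _ (W.sub_mem hpW hqW))
    rw [sub_add_sub_cancel] at h
    have h0 : ‖p - q‖ = 0 := by
      by_contra h0
      have : 0 < ‖p - q‖ := lt_of_le_of_ne (norm_nonneg _) (Ne.symm h0)
      nlinarith [norm_nonneg (F - q), norm_nonneg (F - p)]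
    exact sub_eq_zero.1 (norm_eq_zero.1 h0)
  have hpm : Measurable p := (Lp.stronglyMeasurable p).measurable
  set g : X → ℝ := fun x => unitClamp (p x) with hg
  have hgm : Measurable g := lipschitzWith_unitClamp.continuous.measurable.comp hpm
  have hgp : p =ᵐ[μ] g := by
    have h := lipschitzWith_unitClamp.coeFn_compLp unitClamp_zero p
    rw [← hq, ← hpq] at h
    exact h
  have hu : (F - p : Lp ℝ 2 μ) =ᵐ[μ] fun x => f x - g x := by
    filter_upwards [Lp.coeFn_sub F p, hFf, hgp] with x h1 h2 h3
    rw [h1, Pi.sub_apply, h2, h3]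
  refine ⟨g, hgm, fun x => unitClamp_nonneg _, fun x => unitClamp_le_one _, ?_, ?_, ?_⟩
  · let one : Lp ℝ 2 μ := Lp.const 2 μ (1 : ℝ)
    have hone : one =ᵐ[μ] fun _ => (1 : ℝ) := Lp.coeFn_const ..
    have honeW : one ∈ W := by
      refine mem_almostPeriodic_of_forall_finite fun ε hε => ⟨{one}, Set.finite_singleton _,
        fun n => ⟨one, rfl, ?_⟩⟩
      have : koopman hmp n one = one := by
        ext1
        have h := (hmp n).quasiMeasurePreserving.ae_eq_comp hone
        filter_upwards [coeFn_koopman hmp n one, h, hone] with x h1 h2 h3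
        rw [h1, h3]
        exact h2
      simpa [this] using hε
    have h := (Submodule.mem_orthogonal W _).1 hort one honeW
    rw [L2.inner_def] at h
    have h' : ∫ x, (f x - g x) ∂μ = 0 := by
      rw [← h]
      refine integral_congr_ae ?_
      filter_upwards [hone, hu] with x h1 h2
      rw [h1, h2]
      simp
    rw [integral_sub] at h'
    · linarith
    · exact integrable_of_abs_le hf (C := 1) fun x => abs_le.2 ⟨by linarith [hf0 x], hf1 x⟩
    · exact integrable_of_abs_le hgm (C := 1) fun x =>
        abs_le.2 ⟨by linarith [unitClamp_nonneg (p x)], unitClamp_le_one _⟩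
  · intro ε hε
    obtain ⟨S, hS⟩ := exists_finset_of_mem_almostPeriodic hpW hε
    refine ⟨S, fun n => ?_⟩
    obtain ⟨k, hk, hn⟩ := hS n
    refine ⟨k, hk, (le_of_eq ?_).trans ((integral_abs_le_norm _).trans hn.le)⟩
    refine integral_congr_ae ?_
    have h1 := (hmp n).quasiMeasurePreserving.ae_eq_comp hgp
    have h2 := (hmp k).quasiMeasurePreserving.ae_eq_comp hgp
    filter_upwards [Lp.coeFn_sub (koopman hmp n p) (koopman hmp k p), coeFn_koopman hmp n p,
      coeFn_koopman hmp k p, h1, h2] with x h3 h4 h5 h6 h7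
    rw [h3, Pi.sub_apply, h4, h5]
    simp only [Function.comp_apply] at h6 h7
    rw [h6, h7]
  · have h := tendsto_expect_inner_sq_of_mem_orthogonal (koopman hmp) (F - p)
      (koopman_zero hmp hτ.zero_apply) (koopman_add hmp hτ.add_apply) hort
    refine h.congr fun N => Finset.expect_congr rfl fun n _ => ?_
    congr 1
    rw [L2.inner_def]
    refine integral_congr_ae ?_
    have h1 := (hmp n).quasiMeasurePreserving.ae_eq_comp hu
    filter_upwards [coeFn_koopman hmp n (F - p), h1, hu] with x h2 h3 h4
    rw [h2, h4]
    simp only [Function.comp_apply] at h3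
    rw [h3]
    simp [mul_comm]

end MeasureFlow

section BoxAverages

lemma pow_four_expect_expect_le {ι κ : Type*} (I : Finset ι) (J : Finset κ) {a : ι → ℝ}
    {b : κ → ℝ} (c : ι → κ → ℝ) (ha : ∀ i, |a i| ≤ 1) (hb : ∀ j, |b j| ≤ 1) :
    (𝔼 i ∈ I, 𝔼 j ∈ J, a i * b j * c i j) ^ 4 ≤
      𝔼 j ∈ J, 𝔼 j' ∈ J, (𝔼 i ∈ I, c i j * c i j') ^ 2 := by
  have h1 : (𝔼 i ∈ I, 𝔼 j ∈ J, a i * b j * c i j) ^ 2 ≤ 𝔼 i ∈ I, (𝔼 j ∈ J, b j * c i j) ^ 2 := by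
    refine (sq_expect_le_expect_sq _ _).trans (Finset.expect_le_expect fun i _ => ?_)
    simp_rw [mul_assoc, ← Finset.mul_expect, mul_pow]
    exact mul_le_of_le_one_left (sq_nonneg _) ((sq_le_one_iff_abs_le_one _).2 (ha i))
  have h2 : 𝔼 i ∈ I, (𝔼 j ∈ J, b j * c i j) ^ 2 =
      𝔼 j ∈ J, 𝔼 j' ∈ J, b j * b j' * 𝔼 i ∈ I, c i j * c i j' := by
    simp_rw [sq, Finset.expect_mul_expect, Finset.mul_expect]
    rw [Finset.expect_comm]
    refine Finset.expect_congr rfl fun j _ => ?_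
    rw [Finset.expect_comm]
    refine Finset.expect_congr rfl fun j' _ => Finset.expect_congr rfl fun i _ => ?_
    ring
  rw [h2] at h1
  calc (𝔼 i ∈ I, 𝔼 j ∈ J, a i * b j * c i j) ^ 4
      = ((𝔼 i ∈ I, 𝔼 j ∈ J, a i * b j * c i j) ^ 2) ^ 2 := by ring
    _ ≤ (𝔼 j ∈ J, 𝔼 j' ∈ J, b j * b j' * 𝔼 i ∈ I, c i j * c i j') ^ 2 :=
        pow_le_pow_left₀ (sq_nonneg _) h1 2
    _ ≤ _ := by
        refine (sq_expect_le_expect_sq _ _).trans (Finset.expect_le_expect fun j _ => ?_)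
        refine (sq_expect_le_expect_sq _ _).trans (Finset.expect_le_expect fun j' _ => ?_)
        rw [mul_pow]
        refine mul_le_of_le_one_left (sq_nonneg _) ((sq_le_one_iff_abs_le_one _).2 ?_)
        rw [abs_mul]
        exact mul_le_one₀ (hb j) (abs_nonneg _) (hb j')

lemma expect_Ico_comp_neg (φ : ℤ → ℝ) (a b : ℤ) :
    𝔼 n ∈ Finset.Ico a b, φ (-n) = 𝔼 n ∈ Finset.Ico (1 - b) (1 - a), φ n := by
  refine Finset.expect_nbij' (fun n => -n) (fun n => -n) ?_ ?_ ?_ ?_ ?_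
  · intro n hn
    rw [Finset.mem_Ico] at hn ⊢
    lia
  · intro n hn
    rw [Finset.mem_Ico] at hn ⊢
    lia
  · simp
  · simp
  · simp

lemma expect_Ico_comp_sub (φ : ℤ → ℝ) (a b c : ℤ) :
    𝔼 n ∈ Finset.Ico a b, φ (n - c) = 𝔼 n ∈ Finset.Ico (a - c) (b - c), φ n := by
  refine Finset.expect_nbij' (fun n => n - c) (fun n => n + c) ?_ ?_ ?_ ?_ ?_
  · intro n hn
    rw [Finset.mem_Ico] at hn ⊢
    lia
  · intro n hn
    rw [Finset.mem_Ico] at hn ⊢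
    lia
  · simp
  · simp
  · simp

lemma expect_expect_sub_le {φ : ℤ → ℝ} (h0 : ∀ k, 0 ≤ φ k) (heven : ∀ k, φ (-k) = φ k)
    (b : ℤ) {L : ℕ} (hL : 0 < L) :
    𝔼 m ∈ Finset.Ico b (b + L), 𝔼 m' ∈ Finset.Ico b (b + L), φ (m' - m) ≤
      2 * 𝔼 h ∈ Finset.Ico (0 : ℤ) L, φ h := by
  have hne : (Finset.Ico b (b + L)).Nonempty := by
    rw [Finset.nonempty_Ico]
    lia
  refine Finset.expect_le hne fun m hm => ?_
  rw [Finset.mem_Ico] at hm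
  rw [expect_Ico_comp_sub, Finset.expect_eq_sum_div_card, Finset.expect_eq_sum_div_card,
    Int.card_Ico, Int.card_Ico, ← mul_div_assoc]
  have hc : (b + L - m - (b - m)).toNat = ((L : ℤ) - 0).toNat := by congr 1; ring
  rw [hc]
  gcongr
  have hneg : ∑ h ∈ Finset.Ico (1 - L : ℤ) 0, φ h = ∑ h ∈ Finset.Ico (1 : ℤ) L, φ h := by
    refine Finset.sum_nbij' (fun n => -n) (fun n => -n) ?_ ?_ ?_ ?_ ?_
    · intro n hn
      rw [Finset.mem_Ico] at hn ⊢
      lia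
    · intro n hn
      rw [Finset.mem_Ico] at hn ⊢
      lia
    · simp
    · simp
    · simp [heven]
  calc ∑ h ∈ Finset.Ico (b - m) (b + L - m), φ h
      ≤ ∑ h ∈ Finset.Ico (1 - L : ℤ) 0 ∪ Finset.Ico (0 : ℤ) L, φ h := by
        refine Finset.sum_le_sum_of_subset_of_nonneg (fun k hk => ?_) fun k _ _ => h0 k
        rw [Finset.mem_Ico] at hk
        rw [Finset.mem_union, Finset.mem_Ico, Finset.mem_Ico]
        lia
    _ ≤ ∑ h ∈ Finset.Ico (1 - L : ℤ) 0, φ h + ∑ h ∈ Finset.Ico (0 : ℤ) L, φ h := by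
        rw [← Finset.sum_union_inter]
        exact le_add_of_nonneg_right (Finset.sum_nonneg fun k _ => h0 k)
    _ ≤ ∑ h ∈ Finset.Ico (0 : ℤ) L, φ h + ∑ h ∈ Finset.Ico (0 : ℤ) L, φ h := by
        rw [hneg]
        gcongr ?_ + _
        refine Finset.sum_le_sum_of_subset_of_nonneg (fun k hk => ?_) fun k _ _ => h0 k
        rw [Finset.mem_Ico] at hk ⊢
        lia
    _ = _ := by ring

end BoxAverages

section CubeCorrelations

variable {X : Type*} [MeasurableSpace X]

lemma integral_expect {ι : Type*} {μ : Measure X} (s : Finset ι) {F : ι → X → ℝ}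
    (h : ∀ i, Integrable (F i) μ) :
    ∫ x, 𝔼 i ∈ s, F i x ∂μ = 𝔼 i ∈ s, ∫ x, F i x ∂μ := by
  simp_rw [Finset.expect_eq_sum_div_card]
  rw [integral_div, integral_finsetSum _ fun i _ => h i]

lemma measurable_expect {ι : Type*} (s : Finset ι) {F : ι → X → ℝ}
    (h : ∀ i, Measurable (F i)) : Measurable fun x => 𝔼 i ∈ s, F i x := by
  simp_rw [Finset.expect_eq_sum_div_card]
  exact (Finset.measurable_sum _ fun i _ => h i).div_const _

lemma abs_mul_le_one {a b : ℝ} (ha : |a| ≤ 1) (hb : |b| ≤ 1) : |a * b| ≤ 1 := by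
  rw [abs_mul]
  exact mul_le_one₀ ha (abs_nonneg _) hb

variable {μ : Measure X} {τ : ℤ → X → X}

/-- The correlation of four functions along the vertices of a parallelogram. -/
noncomputable def cubeCorrelation (μ : Measure X) (τ : ℤ → X → X) (f₀ f₁ f₂ f₃ : X → ℝ)
    (n m : ℤ) : ℝ :=
  ∫ x, f₀ x * f₁ (τ n x) * f₂ (τ m x) * f₃ (τ (n + m) x) ∂μ

namespace IsErgodicFlow

lemma measurable (hτ : IsErgodicFlow μ τ) (n : ℤ) : Measurable (τ n) :=
  (hτ.measurePreserving n).measurable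

lemma integral_comp (hτ : IsErgodicFlow μ τ) {φ : X → ℝ} (hφ : Measurable φ) (n : ℤ) :
    ∫ x, φ (τ n x) ∂μ = ∫ x, φ x ∂μ := by
  conv_rhs => rw [← (hτ.measurePreserving n).map_eq]
  rw [integral_map (hτ.measurable n).aemeasurable hφ.aestronglyMeasurable]

lemma eventually_abs_expect_sub_le (hτ : IsErgodicFlow μ τ) {g h : X → ℝ} (hg : Measurable g)
    (hh : Measurable h) (hg1 : ∀ x, |g x| ≤ 1) (hh1 : ∀ x, |h x| ≤ 1) {ε : ℝ} (hε : 0 < ε) :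
    ∀ᶠ L : ℕ in atTop, ∀ a : ℤ, |𝔼 n ∈ Finset.Ico a (a + L), ∫ x, g x * h (τ n x) ∂μ -
      (∫ x, g x ∂μ) * ∫ x, h x ∂μ| ≤ ε := by
  obtain ⟨L, hL⟩ := hτ.exists_abs_expect_sub_le g h hg hh hg1 hh1 ε hε
  filter_upwards [eventually_ge_atTop L] with L' hL' a
  exact hL a _ (by lia)

lemma cubeCorrelation_neg_left (hτ : IsErgodicFlow μ τ) {f₀ f₁ f₂ f₃ : X → ℝ}
    (h₀ : Measurable f₀) (h₁ : Measurable f₁) (h₂ : Measurable f₂) (h₃ : Measurable f₃)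
    (n m : ℤ) :
    cubeCorrelation μ τ f₀ f₁ f₂ f₃ n m = cubeCorrelation μ τ f₁ f₀ f₃ f₂ (-n) m := by
  have hm := hτ.measurable
  unfold cubeCorrelation
  rw [← hτ.integral_comp (n := -n) (by fun_prop)]
  refine integral_congr_ae (Eventually.of_forall fun x => ?_)
  simp only [← hτ.add_apply]
  rw [add_neg_cancel, hτ.zero_apply, add_neg_cancel_comm, add_comm m]
  ring

lemma cubeCorrelation_swap (f₀ f₁ f₂ f₃ : X → ℝ) (n m : ℤ) :
    cubeCorrelation μ τ f₀ f₁ f₂ f₃ n m = cubeCorrelation μ τ f₀ f₂ f₁ f₃ m n := by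
  unfold cubeCorrelation
  refine integral_congr_ae (Eventually.of_forall fun x => ?_)
  simp only [add_comm n m]
  ring

lemma cubeCorrelation_neg_right (hτ : IsErgodicFlow μ τ) {f₀ f₁ f₂ f₃ : X → ℝ}
    (h₀ : Measurable f₀) (h₁ : Measurable f₁) (h₂ : Measurable f₂) (h₃ : Measurable f₃)
    (n m : ℤ) :
    cubeCorrelation μ τ f₀ f₁ f₂ f₃ n m = cubeCorrelation μ τ f₂ f₃ f₀ f₁ n (-m) := by
  rw [cubeCorrelation_swap, hτ.cubeCorrelation_neg_left h₀ h₂ h₁ h₃, cubeCorrelation_swap]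

lemma pow_four_expect_cubeCorrelation_le [IsProbabilityMeasure μ] (hτ : IsErgodicFlow μ τ)
    {f₀ f₁ f₂ u : X → ℝ} (h₀ : Measurable f₀) (h₁ : Measurable f₁) (h₂ : Measurable f₂)
    (hu : Measurable u) (b₀ : ∀ x, |f₀ x| ≤ 1) (b₁ : ∀ x, |f₁ x| ≤ 1) (b₂ : ∀ x, |f₂ x| ≤ 1)
    (bu : ∀ x, |u x| ≤ 1) (I J : Finset ℤ) :
    (𝔼 n ∈ I, 𝔼 m ∈ J, cubeCorrelation μ τ f₀ f₁ f₂ u n m) ^ 4 ≤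
      𝔼 m ∈ J, 𝔼 m' ∈ J, 𝔼 n ∈ I, 𝔼 n' ∈ I,
        ∫ x, (u x * u (τ (m' - m) x)) * (u (τ (n' - n) x) * u (τ (m' - m) (τ (n' - n) x))) ∂μ := by
  have hm := hτ.measurable
  let P : ℤ → ℤ → X → ℝ := fun n m x => f₀ x * f₁ (τ n x) * f₂ (τ m x) * u (τ (n + m) x)
  have hPm : ∀ n m, Measurable (P n m) := fun n m => by fun_prop
  have hPb : ∀ n m x, |P n m x| ≤ 1 := fun n m x =>
    abs_mul_le_one (abs_mul_le_one (abs_mul_le_one (b₀ _) (b₁ _)) (b₂ _)) (bu _)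
  let Q : X → ℝ := fun x => 𝔼 n ∈ I, 𝔼 m ∈ J, P n m x
  have hQm : Measurable Q := measurable_expect _ fun n => measurable_expect _ fun m => hPm n m
  have hQb : ∀ x, |Q x| ≤ 1 := fun x => abs_expect_le_of_abs_le zero_le_one fun n =>
    abs_expect_le_of_abs_le zero_le_one fun m => hPb n m x
  have hQ : 𝔼 n ∈ I, 𝔼 m ∈ J, cubeCorrelation μ τ f₀ f₁ f₂ u n m = ∫ x, Q x ∂μ := by
    rw [integral_expect _ fun n => integrable_of_abs_le (measurable_expect _ fun m => hPm n m)
      fun x => abs_expect_le_of_abs_le zero_le_one fun m => hPb n m x]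
    refine Finset.expect_congr rfl fun n _ => ?_
    rw [integral_expect _ fun m => integrable_of_abs_le (hPm n m) (hPb n m)]
    rfl
  have hQk : ∀ k, Integrable (fun x => Q x ^ k) μ := fun k =>
    integrable_of_abs_le (hQm.pow_const k) (C := 1) fun x => by
      rw [abs_pow]
      exact pow_le_one₀ (abs_nonneg _) (hQb x)
  let D : ℤ → ℤ → X → ℝ := fun m m' x => 𝔼 n ∈ I, u (τ (n + m) x) * u (τ (n + m') x)
  have hDm : ∀ m m', Measurable (D m m') := fun m m' => measurable_expect _ fun n => by fun_prop
  have hDb : ∀ m m' x, |D m m' x| ≤ 1 := fun m m' x =>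
    abs_expect_le_of_abs_le zero_le_one fun n => abs_mul_le_one (bu _) (bu _)
  have hD2m : ∀ m m', Measurable fun x => D m m' x ^ 2 := fun m m' => (hDm m m').pow_const 2
  have hD2b : ∀ m m' x, |D m m' x ^ 2| ≤ 1 := fun m m' x => by
    rw [sq]
    exact abs_mul_le_one (hDb _ _ _) (hDb _ _ _)
  have hpt : ∀ x, Q x ^ 4 ≤ 𝔼 m ∈ J, 𝔼 m' ∈ J, D m m' x ^ 2 := fun x =>
    pow_four_expect_expect_le I J (fun n m => u (τ (n + m) x))
      (fun n => abs_mul_le_one (b₀ x) (b₁ (τ n x))) fun m => b₂ (τ m x)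
  have h4 : (∫ x, Q x ∂μ) ^ 4 ≤ ∫ x, Q x ^ 4 ∂μ := by
    have e1 := sq_integral_le_integral_sq (by simpa using hQk 1) (hQk 2)
    have e2 := sq_integral_le_integral_sq (hQk 2) (by simpa [← pow_mul] using hQk 4)
    simp only [← pow_mul] at e2
    calc (∫ x, Q x ∂μ) ^ 4 = ((∫ x, Q x ∂μ) ^ 2) ^ 2 := by ring
      _ ≤ (∫ x, Q x ^ 2 ∂μ) ^ 2 := pow_le_pow_left₀ (sq_nonneg _) e1 2
      _ ≤ _ := e2
  rw [hQ]
  refine h4.trans ((integral_mono (hQk 4) (integrable_of_abs_le (measurable_expect _ fun m =>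
    measurable_expect _ fun m' => hD2m m m') fun x => abs_expect_le_of_abs_le zero_le_one fun m =>
    abs_expect_le_of_abs_le zero_le_one fun m' => hD2b m m' x) hpt).trans_eq ?_)
  rw [integral_expect _ fun m => integrable_of_abs_le (measurable_expect _ fun m' => hD2m m m')
    fun x => abs_expect_le_of_abs_le zero_le_one fun m' => hD2b m m' x]
  refine Finset.expect_congr rfl fun m _ => ?_
  rw [integral_expect _ fun m' => integrable_of_abs_le (hD2m m m') (hD2b m m')]
  refine Finset.expect_congr rfl fun m' _ => ?_
  have hE : ∀ n n', Measurable fun x =>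
      (u (τ (n + m) x) * u (τ (n + m') x)) * (u (τ (n' + m) x) * u (τ (n' + m') x)) :=
    fun n n' => by fun_prop
  have hEb : ∀ n n' x,
      |(u (τ (n + m) x) * u (τ (n + m') x)) * (u (τ (n' + m) x) * u (τ (n' + m') x))| ≤ 1 :=
    fun n n' x => abs_mul_le_one (abs_mul_le_one (bu _) (bu _)) (abs_mul_le_one (bu _) (bu _))
  simp only [D, sq, Finset.expect_mul_expect]
  rw [integral_expect _ fun n => integrable_of_abs_le (measurable_expect _ fun n' => hE n n')
    fun x => abs_expect_le_of_abs_le zero_le_one fun n' => hEb n n' x]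
  refine Finset.expect_congr rfl fun n _ => ?_
  rw [integral_expect _ fun n' => integrable_of_abs_le (hE n n') (hEb n n')]
  refine Finset.expect_congr rfl fun n' _ => ?_
  rw [← hτ.integral_comp (n := n + m) (φ := fun x => (u x * u (τ (m' - m) x)) *
    (u (τ (n' - n) x) * u (τ (m' - m) (τ (n' - n) x)))) (by fun_prop)]
  refine integral_congr_ae (Eventually.of_forall fun x => ?_)
  simp only [← hτ.add_apply]
  ring_nf

/-- Averages of parallelogram correlations over long thin rectangles are small as soon as the
autocorrelations of one of the functions are small on average. -/
lemma eventually_abs_expect_cubeCorrelation_le [IsProbabilityMeasure μ] (hτ : IsErgodicFlow μ τ)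
    {u : X → ℝ} (hu : Measurable u) (bu : ∀ x, |u x| ≤ 1)
    (hlim : Tendsto (fun N : ℕ => 𝔼 n ∈ Finset.Ico (0 : ℤ) N, (∫ x, u x * u (τ n x) ∂μ) ^ 2)
      atTop (𝓝 0)) {ε : ℝ} (hε : 0 < ε) :
    ∀ᶠ N : ℕ in atTop, ∀ᶠ M : ℕ in atTop, ∀ f₀ f₁ f₂ : X → ℝ, Measurable f₀ → Measurable f₁ →
      Measurable f₂ → (∀ x, |f₀ x| ≤ 1) → (∀ x, |f₁ x| ≤ 1) → (∀ x, |f₂ x| ≤ 1) → ∀ a b : ℤ,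
      |𝔼 n ∈ Finset.Ico a (a + M), 𝔼 m ∈ Finset.Ico b (b + N),
        cubeCorrelation μ τ f₀ f₁ f₂ u n m| ≤ ε := by
  have hm := hτ.measurable
  set c : ℤ → ℝ := fun h => ∫ x, u x * u (τ h x) ∂μ with hc
  have hceven : ∀ h, c (-h) ^ 2 = c h ^ 2 := fun h => by
    congr 1
    simp only [hc]
    rw [← hτ.integral_comp (n := h) (by fun_prop)]
    refine integral_congr_ae (Eventually.of_forall fun x => ?_)
    simp only [← hτ.add_apply, neg_add_cancel, hτ.zero_apply]
    ring
  have hη : 0 < ε ^ 4 / 4 := by positivity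
  filter_upwards [hlim.eventually (gt_mem_nhds hη), eventually_gt_atTop 0] with N hN hN0
  have hall : ∀ᶠ M : ℕ in atTop, ∀ h ∈ Finset.Ioo (-(N : ℤ)) N, ∀ a : ℤ,
      |𝔼 n ∈ Finset.Ico a (a + M), ∫ x, (u x * u (τ h x)) * (u (τ n x) * u (τ h (τ n x))) ∂μ -
        (∫ x, u x * u (τ h x) ∂μ) * ∫ x, u x * u (τ h x) ∂μ| ≤ ε ^ 4 / 4 := by
    rw [Filter.eventually_all_finset]
    intro h _
    exact hτ.eventually_abs_expect_sub_le (g := fun x => u x * u (τ h x))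
      (h := fun x => u x * u (τ h x)) (by fun_prop) (by fun_prop)
      (fun x => abs_mul_le_one (bu _) (bu _)) (fun x => abs_mul_le_one (bu _) (bu _)) hη
  filter_upwards [hall, eventually_gt_atTop 0] with M hM hM0 f₀ f₁ f₂ h₀ h₁ h₂ b₀ b₁ b₂ a b
  have hneJ : (Finset.Ico b (b + N)).Nonempty := by
    rw [Finset.nonempty_Ico]
    lia
  have hneI : (Finset.Ico a (a + M)).Nonempty := by
    rw [Finset.nonempty_Ico]
    lia
  refine le_of_pow_le_pow_left₀ (n := 4) (by norm_num) hε.le ?_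
  rw [Even.pow_abs (by decide)]
  refine (hτ.pow_four_expect_cubeCorrelation_le h₀ h₁ h₂ hu b₀ b₁ b₂ bu _ _).trans ?_
  calc _ ≤ 𝔼 m ∈ Finset.Ico b (b + N), 𝔼 m' ∈ Finset.Ico b (b + N),
        (c (m' - m) ^ 2 + ε ^ 4 / 4) := by
        refine Finset.expect_le_expect fun m hmJ => Finset.expect_le_expect fun m' hmJ' => ?_
        refine Finset.expect_le hneI fun n _ => ?_
        rw [Finset.mem_Ico] at hmJ hmJ'
        have hmem : m' - m ∈ Finset.Ioo (-(N : ℤ)) N := by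
          rw [Finset.mem_Ioo]
          lia
        have key := (abs_le.1 (hM _ hmem (a - n))).2
        rw [expect_Ico_comp_sub (fun k => ∫ x, (u x * u (τ (m' - m) x)) *
          (u (τ k x) * u (τ (m' - m) (τ k x))) ∂μ), show a + M - n = a - n + M by ring, sq]
        linarith
    _ = 𝔼 m ∈ Finset.Ico b (b + N), 𝔼 m' ∈ Finset.Ico b (b + N), c (m' - m) ^ 2 + ε ^ 4 / 4 := by
        simp_rw [Finset.expect_add_distrib, Finset.expect_const hneJ]
    _ ≤ 2 * 𝔼 h ∈ Finset.Ico (0 : ℤ) N, c h ^ 2 + ε ^ 4 / 4 := by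
        gcongr
        exact expect_expect_sub_le (φ := fun k => c k ^ 2) (fun k => sq_nonneg _) hceven b hN0
    _ ≤ ε ^ 4 := by
        nlinarith [hN]

end IsErgodicFlow

end CubeCorrelations

section ErgodicCounting

variable {X : Type*} [MeasurableSpace X] {μ : Measure X} {τ : ℤ → X → X}

namespace IsErgodicFlow

lemma eventually_le_expect_cubeCorrelation_self [IsProbabilityMeasure μ]
    (hτ : IsErgodicFlow μ τ) {g : X → ℝ} (hg : Measurable g) (hg0 : ∀ x, 0 ≤ g x)
    (hg1 : ∀ x, g x ≤ 1)
    (hap : ∀ ε > 0, ∃ F : Finset ℤ, ∀ n, ∃ k ∈ F, ∫ x, |g (τ n x) - g (τ k x)| ∂μ ≤ ε)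
    {ε : ℝ} (hε : 0 < ε) :
    ∀ᶠ N : ℕ in atTop, ∀ᶠ M : ℕ in atTop, ∀ a b : ℤ,
      (∫ x, g x ∂μ) ^ 4 - ε ≤ 𝔼 n ∈ Finset.Ico a (a + M), 𝔼 m ∈ Finset.Ico b (b + N),
        cubeCorrelation μ τ g g g g n m := by
  have hm := hτ.measurable
  have bg : ∀ x, |g x| ≤ 1 := fun x => abs_le.2 ⟨by linarith [hg0 x], hg1 x⟩
  obtain ⟨η, hη, rfl⟩ : ∃ η : ℝ, 0 < η ∧ 7 * η = ε := ⟨ε / 7, by positivity, by ring⟩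
  obtain ⟨F, hF⟩ := hap η hη
  let h : ℤ → X → ℝ := fun m x => g x * g (τ m x)
  have hhm : ∀ m, Measurable (h m) := fun m => by fun_prop
  have hhb : ∀ m x, |h m x| ≤ 1 := fun m x => abs_mul_le_one (bg _) (bg _)
  have hhi : ∀ m, Integrable (h m) μ := fun m => integrable_of_abs_le (hhm m) (hhb m)
  have hall : ∀ᶠ M : ℕ in atTop, ∀ k ∈ F, ∀ a : ℤ,
      |𝔼 n ∈ Finset.Ico a (a + M), ∫ x, h k x * h k (τ n x) ∂μ -
        (∫ x, h k x ∂μ) * ∫ x, h k x ∂μ| ≤ η := by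
    rw [Filter.eventually_all_finset]
    exact fun k _ => hτ.eventually_abs_expect_sub_le (hhm k) (hhm k) (hhb k) (hhb k) hη
  filter_upwards [hτ.eventually_abs_expect_sub_le hg hg bg bg hη, eventually_gt_atTop 0]
    with N hN hN0
  filter_upwards [hall, eventually_gt_atTop 0] with M hM hM0 a b
  have hneJ : (Finset.Ico b (b + N)).Nonempty := by
    rw [Finset.nonempty_Ico]
    lia
  have hneI : (Finset.Ico a (a + M)).Nonempty := by
    rw [Finset.nonempty_Ico]
    lia
  have key : ∀ m, (∫ x, h m x ∂μ) ^ 2 - 5 * η ≤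
      𝔼 n ∈ Finset.Ico a (a + M), cubeCorrelation μ τ g g g g n m := by
    intro m
    obtain ⟨k, hk, hmk⟩ := hF m
    have hdm : Measurable fun x => |g (τ m x) - g (τ k x)| :=
      continuous_abs.measurable.comp (by fun_prop)
    have hdb : ∀ x, |(|g (τ m x) - g (τ k x)|)| ≤ 1 := fun x => by
      rw [abs_abs, abs_le]
      constructor <;> linarith [hg0 (τ m x), hg1 (τ m x), hg0 (τ k x), hg1 (τ k x)]
    have hdi := integrable_of_abs_le (μ := μ) hdm hdb
    have hd : ∀ x, |h m x - h k x| ≤ |g (τ m x) - g (τ k x)| := fun x => by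
      simp only [h]
      rw [← mul_sub, abs_mul]
      exact mul_le_of_le_one_left (abs_nonneg _) (bg x)
    have h1 : |∫ x, h m x ∂μ - ∫ x, h k x ∂μ| ≤ η := by
      rw [← integral_sub (hhi m) (hhi k)]
      exact (abs_integral_le_integral_abs).trans
        ((integral_mono ((hhi m).sub (hhi k)).abs hdi hd).trans hmk)
    have hb1 : ∀ m, |∫ x, h m x ∂μ| ≤ 1 := fun m => by
      refine abs_integral_le_integral_abs.trans ?_
      simpa using integral_mono (hhi m).abs (integrable_const (1 : ℝ)) (hhb m)
    have h2 : (∫ x, h m x ∂μ) ^ 2 - 2 * η ≤ (∫ x, h k x ∂μ) * ∫ x, h k x ∂μ := by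
      have e1 := abs_le.1 (hb1 m)
      have e2 := abs_le.1 (hb1 k)
      have e3 : |(∫ x, h m x ∂μ - ∫ x, h k x ∂μ) * (∫ x, h m x ∂μ + ∫ x, h k x ∂μ)| ≤ η * 2 := by
        rw [abs_mul]
        refine mul_le_mul h1 (abs_le.2 ⟨?_, ?_⟩) (abs_nonneg _) hη.le <;> linarith
      have := (abs_le.1 e3).2
      nlinarith
    have h3 : ∀ n, ∫ x, h k x * h k (τ n x) ∂μ - 2 * η ≤ cubeCorrelation μ τ g g g g n m := by
      intro n
      have e1 : cubeCorrelation μ τ g g g g n m = ∫ x, h m x * h m (τ n x) ∂μ := by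
        unfold cubeCorrelation
        refine integral_congr_ae (Eventually.of_forall fun x => ?_)
        simp only [h, ← hτ.add_apply, add_comm n m]
        ring
      have i1 : ∀ m, Integrable (fun x => h m x * h m (τ n x)) μ := fun m =>
        integrable_of_abs_le (C := 1) ((hhm m).mul ((hhm m).comp (hm n))) fun x =>
          abs_mul_le_one (hhb m _) (hhb m _)
      have i2 : Integrable (fun x => |g (τ m (τ n x)) - g (τ k (τ n x))|) μ :=
        integrable_of_abs_le (hdm.comp (hm n)) fun x => hdb (τ n x)
      have e2 : ∫ x, h k x * h k (τ n x) ∂μ - ∫ x, h m x * h m (τ n x) ∂μ ≤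
          ∫ x, (|g (τ m x) - g (τ k x)| + |g (τ m (τ n x)) - g (τ k (τ n x))|) ∂μ := by
        rw [← integral_sub (i1 k) (i1 m)]
        refine integral_mono ((i1 k).sub (i1 m)) (hdi.add i2) fun x => ?_
        have p1 : |(h k x - h m x) * h k (τ n x)| ≤ |g (τ m x) - g (τ k x)| := by
          rw [abs_mul, abs_sub_comm]
          exact (mul_le_of_le_one_right (abs_nonneg _) (hhb _ _)).trans (hd x)
        have p2 : |(h k (τ n x) - h m (τ n x)) * h m x| ≤
            |g (τ m (τ n x)) - g (τ k (τ n x))| := by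
          rw [abs_mul, abs_sub_comm]
          exact (mul_le_of_le_one_right (abs_nonneg _) (hhb _ _)).trans (hd _)
        have p3 := (abs_le.1 p1).2
        have p4 := (abs_le.1 p2).2
        linarith
      rw [integral_add hdi i2,
        hτ.integral_comp (φ := fun x => |g (τ m x) - g (τ k x)|) hdm n] at e2
      rw [e1]
      linarith
    calc _ ≤ 𝔼 n ∈ Finset.Ico a (a + M), ∫ x, h k x * h k (τ n x) ∂μ - 2 * η := by
          linarith [(abs_le.1 (hM k hk a)).1]
      _ = 𝔼 n ∈ Finset.Ico a (a + M), (∫ x, h k x * h k (τ n x) ∂μ - 2 * η) := by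
          rw [Finset.expect_sub_distrib, Finset.expect_const hneI]
      _ ≤ _ := Finset.expect_le_expect fun n _ => h3 n
  rw [Finset.expect_comm]
  have hJ : (𝔼 m ∈ Finset.Ico b (b + N), ∫ x, h m x ∂μ) ^ 2 - 5 * η ≤
      𝔼 m ∈ Finset.Ico b (b + N), 𝔼 n ∈ Finset.Ico a (a + M),
        cubeCorrelation μ τ g g g g n m := by
    calc _ ≤ 𝔼 m ∈ Finset.Ico b (b + N), (∫ x, h m x ∂μ) ^ 2 - 5 * η := by
          gcongr
          exact sq_expect_le_expect_sq _ _
      _ = 𝔼 m ∈ Finset.Ico b (b + N), ((∫ x, h m x ∂μ) ^ 2 - 5 * η) := by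
          rw [Finset.expect_sub_distrib, Finset.expect_const hneJ]
      _ ≤ _ := Finset.expect_le_expect fun m _ => key m
  have hy := (abs_le.1 (hN b)).1
  have hi0 : 0 ≤ ∫ x, g x ∂μ := integral_nonneg hg0
  have hi1 : ∫ x, g x ∂μ ≤ 1 := by
    simpa using integral_mono (integrable_of_abs_le (μ := μ) hg bg) (integrable_const (1 : ℝ)) hg1
  change -η ≤ 𝔼 m ∈ Finset.Ico b (b + N), ∫ x, h m x ∂μ - _ at hy
  set y := 𝔼 m ∈ Finset.Ico b (b + N), ∫ x, h m x ∂μ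
  set d := ∫ x, g x ∂μ
  have hd1 : d ^ 2 ≤ 1 := pow_le_one₀ hi0 hi1
  nlinarith [sq_nonneg (y - d ^ 2), mul_nonneg (sq_nonneg d) (by linarith : 0 ≤ y - d * d + η),
    mul_nonneg (sub_nonneg.2 hd1) hη.le]

lemma integrable_cubeCorrelation [IsProbabilityMeasure μ] (hτ : IsErgodicFlow μ τ)
    {f₀ f₁ f₂ f₃ : X → ℝ} (h₀ : Measurable f₀) (h₁ : Measurable f₁) (h₂ : Measurable f₂)
    (h₃ : Measurable f₃) (b₀ : ∀ x, |f₀ x| ≤ 1) (b₁ : ∀ x, |f₁ x| ≤ 1) (b₂ : ∀ x, |f₂ x| ≤ 1)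
    (b₃ : ∀ x, |f₃ x| ≤ 1) (n m : ℤ) :
    Integrable (fun x => f₀ x * f₁ (τ n x) * f₂ (τ m x) * f₃ (τ (n + m) x)) μ := by
  have hm := hτ.measurable
  exact integrable_of_abs_le (C := 1) (by fun_prop) fun x =>
    abs_mul_le_one (abs_mul_le_one (abs_mul_le_one (b₀ _) (b₁ _)) (b₂ _)) (b₃ _)

/-- In an ergodic flow, parallelograms with almost the expected measure of returns occur
syndetically. -/
theorem exists_lt_cubeCorrelation [IsProbabilityMeasure μ] (hτ : IsErgodicFlow μ τ) {f : X → ℝ}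
    (hf : Measurable f) (hf0 : ∀ x, 0 ≤ f x) (hf1 : ∀ x, f x ≤ 1) {ε : ℝ} (hε : 0 < ε) :
    ∃ L : ℤ, 0 < L ∧ ∀ a b : ℤ, ∃ n m : ℤ, a ≤ n ∧ n < a + L ∧ b ≤ m ∧ m < b + L ∧
      (∫ x, f x ∂μ) ^ 4 - ε < cubeCorrelation μ τ f f f f n m := by
  obtain ⟨g, hg, hg0, hg1, hfg, hap, hlim⟩ := exists_almostPeriodic_decomposition hτ hf hf0 hf1
  have bf : ∀ x, |f x| ≤ 1 := fun x => abs_le.2 ⟨by linarith [hf0 x], hf1 x⟩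
  have bg : ∀ x, |g x| ≤ 1 := fun x => abs_le.2 ⟨by linarith [hg0 x], hg1 x⟩
  set u : X → ℝ := fun x => f x - g x with hu_def
  have hu : Measurable u := hf.sub hg
  have bu : ∀ x, |u x| ≤ 1 := fun x =>
    abs_le.2 ⟨by linarith [hf0 x, hg1 x], by linarith [hf1 x, hg0 x]⟩
  have hη : 0 < ε / 6 := by positivity
  obtain ⟨N, hN, hN1, hN0⟩ := ((hτ.eventually_abs_expect_cubeCorrelation_le hu bu hlim hη).and
    ((hτ.eventually_le_expect_cubeCorrelation_self hg hg0 hg1 hap hη).and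
      (eventually_gt_atTop 0))).exists
  obtain ⟨M, hM, hM1, hM0⟩ := (hN.and (hN1.and (eventually_gt_atTop 0))).exists
  refine ⟨max M N, by lia, fun a b => ?_⟩
  have hneJ : (Finset.Ico b (b + N)).Nonempty := by
    rw [Finset.nonempty_Ico]
    lia
  have hneI : (Finset.Ico a (a + M)).Nonempty := by
    rw [Finset.nonempty_Ico]
    lia
  have hsplit : ∀ n m, cubeCorrelation μ τ f f f f n m =
      cubeCorrelation μ τ g g g g n m + cubeCorrelation μ τ f f f u n m +
      cubeCorrelation μ τ f f g u (-n) m + cubeCorrelation μ τ g g f u n (-m) +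
      cubeCorrelation μ τ g g g u (-n) (-m) := by
    intro n m
    rw [← hτ.cubeCorrelation_neg_left hf hf hu hg, ← hτ.cubeCorrelation_neg_right hf hu hg hg,
      ← hτ.cubeCorrelation_neg_right hg hu hg hg, ← hτ.cubeCorrelation_neg_left hu hg hg hg]
    have i1 := hτ.integrable_cubeCorrelation hg hg hg hg bg bg bg bg n m
    have i2 := hτ.integrable_cubeCorrelation hf hf hf hu bf bf bf bu n m
    have i3 := hτ.integrable_cubeCorrelation hf hf hu hg bf bf bu bg n m
    have i4 := hτ.integrable_cubeCorrelation hf hu hg hg bf bu bg bg n m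
    have i5 := hτ.integrable_cubeCorrelation hu hg hg hg bu bg bg bg n m
    unfold cubeCorrelation
    rw [← integral_add' i1 i2, ← integral_add' (i1.add i2) i3,
      ← integral_add' ((i1.add i2).add i3) i4, ← integral_add' (((i1.add i2).add i3).add i4) i5]
    refine integral_congr_ae (Eventually.of_forall fun x => ?_)
    simp only [Pi.add_apply, hu_def]
    ring
  have hJneg : 1 - b = 1 - (b + N) + N := by ring
  have hIneg : 1 - a = 1 - (a + M) + M := by ring
  have r1 := (abs_le.1 (hM f f f hf hf hf bf bf bf a b)).1
  have r2 := (abs_le.1 (hM f f g hf hf hg bf bf bg (1 - (a + M)) b)).1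
  have r3 := (abs_le.1 (hM g g f hg hg hf bg bg bf a (1 - (b + N)))).1
  have r4 := (abs_le.1 (hM g g g hg hg hg bg bg bg (1 - (a + M)) (1 - (b + N)))).1
  have r0 := hM1 a b
  rw [← hIneg, ← expect_Ico_comp_neg] at r2 r4
  rw [← hJneg] at r3 r4
  simp_rw [← expect_Ico_comp_neg] at r3 r4
  have havg : (∫ x, f x ∂μ) ^ 4 - ε < 𝔼 n ∈ Finset.Ico a (a + M), 𝔼 m ∈ Finset.Ico b (b + N),
      cubeCorrelation μ τ f f f f n m := by
    simp_rw [hsplit, Finset.expect_add_distrib]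
    rw [← hfg]
    linarith
  obtain ⟨n, hn, hn'⟩ := Finset.exists_lt_of_lt_expect hneI havg
  obtain ⟨m, hm, hm'⟩ := Finset.exists_lt_of_lt_expect hneJ hn'
  rw [Finset.mem_Ico] at hn hm
  exact ⟨n, m, hn.1, by lia, hm.1, by lia, hm'⟩

end IsErgodicFlow

end ErgodicCounting

section OrbitMeans

variable {X : Type*} [TopologicalSpace X] {T : ℤ → C(X, X)} {ω : X}

/-- A `ℤ`-action by continuous maps. -/
structure IsContinuousFlow (T : ℤ → C(X, X)) : Prop where
  zero_apply : ∀ x, T 0 x = x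
  add_apply : ∀ a b x, T (a + b) x = T a (T b x)

/-- An invariant, normalized linear functional which is positive on the orbit of `ω`. -/
structure IsOrbitMean (T : ℤ → C(X, X)) (ω : X) (Λ : C(X, ℝ) → ℝ) : Prop where
  map_add : ∀ φ ψ, Λ (φ + ψ) = Λ φ + Λ ψ
  map_smul : ∀ (c : ℝ) φ, Λ (c • φ) = c * Λ φ
  map_one : Λ 1 = 1
  nonneg : ∀ φ : C(X, ℝ), (∀ k, 0 ≤ φ (T k ω)) → 0 ≤ Λ φ
  map_comp : ∀ n φ, Λ (φ.comp (T n)) = Λ φ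

namespace IsOrbitMean

variable {Λ : C(X, ℝ) → ℝ}

/-- An orbit mean as a linear map. -/
def toLinearMap (hΛ : IsOrbitMean T ω Λ) : C(X, ℝ) →ₗ[ℝ] ℝ where
  toFun := Λ
  map_add' := hΛ.map_add
  map_smul' := hΛ.map_smul

lemma map_sub (hΛ : IsOrbitMean T ω Λ) (φ ψ : C(X, ℝ)) : Λ (φ - ψ) = Λ φ - Λ ψ :=
  hΛ.toLinearMap.map_sub φ ψ

lemma map_sum (hΛ : IsOrbitMean T ω Λ) {ι : Type*} (s : Finset ι) (φ : ι → C(X, ℝ)) :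
    Λ (∑ i ∈ s, φ i) = ∑ i ∈ s, Λ (φ i) :=
  _root_.map_sum hΛ.toLinearMap φ s

lemma mono (hΛ : IsOrbitMean T ω Λ) {φ ψ : C(X, ℝ)} (h : ∀ k, φ (T k ω) ≤ ψ (T k ω)) :
    Λ φ ≤ Λ ψ := by
  rw [← sub_nonneg, ← hΛ.map_sub]
  exact hΛ.nonneg _ fun k => sub_nonneg.2 (h k)

lemma map_const (hΛ : IsOrbitMean T ω Λ) (c : ℝ) : Λ (c • 1) = c := by
  rw [hΛ.map_smul, hΛ.map_one, mul_one]

lemma le_of_forall_le (hΛ : IsOrbitMean T ω Λ) {φ : C(X, ℝ)} {C : ℝ}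
    (h : ∀ k, φ (T k ω) ≤ C) : Λ φ ≤ C := by
  rw [← hΛ.map_const C]
  exact hΛ.mono fun k => by simpa using h k

lemma le_of_forall_ge (hΛ : IsOrbitMean T ω Λ) {φ : C(X, ℝ)} {C : ℝ}
    (h : ∀ k, C ≤ φ (T k ω)) : C ≤ Λ φ := by
  rw [← hΛ.map_const C]
  exact hΛ.mono fun k => by simpa using h k

lemma abs_le_of_forall_abs_le (hΛ : IsOrbitMean T ω Λ) {φ : C(X, ℝ)} {C : ℝ}
    (h : ∀ k, |φ (T k ω)| ≤ C) : |Λ φ| ≤ C :=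
  abs_le.2 ⟨hΛ.le_of_forall_ge fun k => (abs_le.1 (h k)).1,
    hΛ.le_of_forall_le fun k => (abs_le.1 (h k)).2⟩

end IsOrbitMean

lemma abs_apply_le_norm [CompactSpace X] (φ : C(X, ℝ)) (x : X) : |φ x| ≤ ‖φ‖ :=
  φ.norm_coe_le_norm x

/-- Averaging along the orbit over long intervals yields orbit means. -/
lemma isOrbitMean_ultraLim [CompactSpace X] (hT : IsContinuousFlow T) (ω : X) {a b : ℕ → ℤ}
    (hab : Tendsto (fun N => b N - a N) atTop atTop) (hlt : ∀ N, a N < b N) :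
    IsOrbitMean T ω fun φ => ultraLim (hyperfilter ℕ : Ultrafilter ℕ) fun N =>
      𝔼 k ∈ Finset.Ico (a N) (b N), φ (T k ω) := by
  have hlim : ∀ φ : C(X, ℝ), Tendsto (fun N => 𝔼 k ∈ Finset.Ico (a N) (b N), φ (T k ω))
      (hyperfilter ℕ : Ultrafilter ℕ) (𝓝 (ultraLim (hyperfilter ℕ : Ultrafilter ℕ) fun N =>
        𝔼 k ∈ Finset.Ico (a N) (b N), φ (T k ω))) := fun φ =>
    tendsto_ultraLim _ fun N => abs_expect_le_of_abs_le (norm_nonneg φ) fun k =>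
      abs_apply_le_norm φ _
  refine ⟨fun φ ψ => ultraLim_eq _ ?_, fun c φ => ultraLim_eq _ ?_, ultraLim_eq _ ?_,
    fun φ h => ?_, fun n φ => ultraLim_eq _ ?_⟩
  · simpa [Finset.expect_add_distrib] using (hlim φ).add (hlim ψ)
  · simpa [Finset.mul_expect] using (hlim φ).const_mul c
  · refine tendsto_const_nhds.congr fun N => ?_
    simp [Finset.expect_const (Finset.nonempty_Ico.2 (hlt N))]
  · exact ge_of_tendsto' (hlim φ) fun N => Finset.expect_nonneg fun k _ => h k
  · have h := (tendsto_expect_Ico_add_sub (x := fun k => φ (T k ω))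
      (fun k => abs_apply_le_norm φ _) n hab).mono_left
      (Nat.hyperfilter_le_atTop)
    simpa [add_comm, hT.add_apply] using h.add (hlim φ)

/-- Weighting an orbit mean by averages of a nonnegative function yields an orbit mean. -/
lemma IsOrbitMean.weighted [CompactSpace X] (hT : IsContinuousFlow T) {Λ : C(X, ℝ) → ℝ}
    (hΛ : IsOrbitMean T ω Λ) {a b : ℕ → ℤ}
    (hab : Tendsto (fun N => b N - a N) atTop atTop) (hlt : ∀ N, a N < b N) (h : C(X, ℝ))
    (h0 : ∀ x, 0 ≤ h x) (hpos : 0 < Λ h) :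
    IsOrbitMean T ω fun φ => (Λ h)⁻¹ * ultraLim (hyperfilter ℕ : Ultrafilter ℕ) fun N =>
      𝔼 k ∈ Finset.Ico (a N) (b N), Λ (φ * h.comp (T k)) := by
  have hbd : ∀ (φ : C(X, ℝ)) k, |Λ (φ * h.comp (T k))| ≤ ‖φ‖ * ‖h‖ := fun φ k =>
    hΛ.abs_le_of_forall_abs_le fun j => by
      simp only [ContinuousMap.mul_apply, ContinuousMap.comp_apply, abs_mul]
      exact mul_le_mul (abs_apply_le_norm _ _) (abs_apply_le_norm _ _) (abs_nonneg _)
        (norm_nonneg _)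
  have hlim : ∀ φ : C(X, ℝ), Tendsto
      (fun N => 𝔼 k ∈ Finset.Ico (a N) (b N), Λ (φ * h.comp (T k)))
      (hyperfilter ℕ : Ultrafilter ℕ) (𝓝 (ultraLim (hyperfilter ℕ : Ultrafilter ℕ) fun N =>
        𝔼 k ∈ Finset.Ico (a N) (b N), Λ (φ * h.comp (T k)))) := fun φ =>
    tendsto_ultraLim _ fun N => abs_expect_le_of_abs_le (by positivity) fun k => hbd φ k
  refine ⟨fun φ ψ => ?_, fun c φ => ?_, ?_, fun φ h => ?_, fun n φ => ?_⟩
  · rw [← mul_add]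
    congr 1
    refine ultraLim_eq _ ?_
    simpa [Finset.expect_add_distrib, add_mul, hΛ.map_add] using (hlim φ).add (hlim ψ)
  · rw [mul_left_comm]
    congr 1
    refine ultraLim_eq _ ?_
    simpa [Finset.mul_expect, hΛ.map_smul] using (hlim φ).const_mul c
  · rw [ultraLim_eq (a := Λ h), inv_mul_cancel₀ hpos.ne']
    refine tendsto_const_nhds.congr fun N => ?_
    simp [hΛ.map_comp, Finset.expect_const (Finset.nonempty_Ico.2 (hlt N))]
  · refine mul_nonneg (inv_nonneg.2 hpos.le) (ge_of_tendsto' (hlim φ) fun N =>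
      Finset.expect_nonneg fun k _ => hΛ.nonneg _ fun j => ?_)
    exact mul_nonneg (h j) (h0 _)
  · congr 1
    refine ultraLim_eq _ ?_
    have h1 := (tendsto_expect_Ico_add_sub (x := fun k => Λ (φ * h.comp (T k)))
      (fun k => hbd φ k) (-n) hab).mono_left Nat.hyperfilter_le_atTop
    have h2 := h1.add (hlim φ)
    simp only [sub_add_cancel, zero_add] at h2
    refine h2.congr fun N => Finset.expect_congr rfl fun k _ => ?_
    rw [← hΛ.map_comp n]
    congr 1
    ext x
    simp [← hT.add_apply]

lemma isCompact_setOf_isOrbitMean [CompactSpace X] (T : ℤ → C(X, X)) (ω : X) :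
    IsCompact {Λ | IsOrbitMean T ω Λ} := by
  have hsub : {Λ | IsOrbitMean T ω Λ} ⊆
      Set.univ.pi fun φ : C(X, ℝ) => Set.Icc (-‖φ‖) ‖φ‖ := fun Λ hΛ φ _ =>
    abs_le.1 (IsOrbitMean.abs_le_of_forall_abs_le hΛ fun k => abs_apply_le_norm φ _)
  refine (isCompact_univ_pi fun φ => isCompact_Icc).of_isClosed_subset ?_ hsub
  have heq : {Λ | IsOrbitMean T ω Λ} =
      (⋂ φ, ⋂ ψ, {Λ | Λ (φ + ψ) = Λ φ + Λ ψ}) ∩ (⋂ c : ℝ, ⋂ φ, {Λ | Λ (c • φ) = c * Λ φ}) ∩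
      {Λ | Λ 1 = 1} ∩ (⋂ φ : C(X, ℝ), ⋂ _ : ∀ k, 0 ≤ φ (T k ω), {Λ | 0 ≤ Λ φ}) ∩
      ⋂ n, ⋂ φ, {Λ | Λ (φ.comp (T n)) = Λ φ} := by
    ext Λ
    simp only [Set.mem_inter_iff, Set.mem_iInter, Set.mem_ofPred_eq]
    exact ⟨fun h => ⟨⟨⟨⟨h.1, h.2⟩, h.3⟩, h.4⟩, h.5⟩, fun h => ⟨h.1.1.1.1, h.1.1.1.2, h.1.1.2,
      h.1.2, h.2⟩⟩
  rw [heq]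
  refine ((((isClosed_iInter fun φ => isClosed_iInter fun ψ => ?_).inter
    (isClosed_iInter fun c => isClosed_iInter fun φ => ?_)).inter ?_).inter
    (isClosed_iInter fun φ => isClosed_iInter fun _ => ?_)).inter
    (isClosed_iInter fun n => isClosed_iInter fun φ => ?_)
  · exact isClosed_eq (continuous_apply _) (by fun_prop)
  · exact isClosed_eq (continuous_apply _) (by fun_prop)
  · exact isClosed_eq (continuous_apply _) continuous_const
  · exact isClosed_le continuous_const (continuous_apply _)
  · exact isClosed_eq (continuous_apply _) (continuous_apply _)

/-- Among the orbit means attaining the maximal value `δ` at `f`, there is an ergodic one. -/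
theorem exists_ergodic_isOrbitMean [CompactSpace X] (hT : IsContinuousFlow T) {f : C(X, ℝ)}
    {δ : ℝ} (hle : ∀ Λ, IsOrbitMean T ω Λ → Λ f ≤ δ) (hex : ∃ Λ, IsOrbitMean T ω Λ ∧ δ ≤ Λ f) :
    ∃ Λ, IsOrbitMean T ω Λ ∧ δ ≤ Λ f ∧ ∀ g h : C(X, ℝ), ∀ ε > 0, ∃ L : ℕ, ∀ a b : ℤ, a + L ≤ b →
      |𝔼 n ∈ Finset.Ico a b, Λ (g * h.comp (T n)) - Λ g * Λ h| ≤ ε := by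
  let S : Set (C(X, ℝ) → ℝ) := {Λ | IsOrbitMean T ω Λ} ∩ {Λ | δ ≤ Λ f}
  have hSc : IsCompact S := (isCompact_setOf_isOrbitMean T ω).inter_right
    (isClosed_le continuous_const (continuous_apply f))
  obtain ⟨Λ, hΛS, hext⟩ := hSc.extremePoints_nonempty hex
  have hΛ : IsOrbitMean T ω Λ := hΛS.1
  have hΛf : δ ≤ Λ f := hΛS.2
  have hlim : ∀ (g h : C(X, ℝ)), (∀ x, 1 / 4 ≤ h x) → (∀ x, h x ≤ 3 / 4) → ∀ a b : ℕ → ℤ,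
      Tendsto (fun N => b N - a N) atTop atTop → (∀ N, a N < b N) →
      Tendsto (fun N => 𝔼 n ∈ Finset.Ico (a N) (b N), Λ (g * h.comp (T n)))
        (hyperfilter ℕ : Ultrafilter ℕ) (𝓝 (Λ g * Λ h)) := by
    intro g h h1 h3 a b hab hlt
    have c1 : 1 / 4 ≤ Λ h := hΛ.le_of_forall_ge fun k => h1 _
    have c3 : Λ h ≤ 3 / 4 := hΛ.le_of_forall_le fun k => h3 _
    have hc : Λ (1 - h) = 1 - Λ h := by rw [hΛ.map_sub, hΛ.map_one]
    have m1 := hΛ.weighted hT hab hlt h (fun x => by linarith [h1 x]) (by linarith)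
    have m2 := hΛ.weighted hT hab hlt (1 - h)
      (fun x => by simp only [ContinuousMap.sub_apply, ContinuousMap.one_apply]; linarith [h3 x])
      (by linarith)
    have hbd : ∀ (h φ : C(X, ℝ)) k, |Λ (φ * h.comp (T k))| ≤ ‖φ‖ * ‖h‖ := fun h φ k =>
      hΛ.abs_le_of_forall_abs_le fun j => by
        simp only [ContinuousMap.mul_apply, ContinuousMap.comp_apply, abs_mul]
        exact mul_le_mul (abs_apply_le_norm _ _) (abs_apply_le_norm _ _) (abs_nonneg _)
          (norm_nonneg _)
    have hl : ∀ h φ : C(X, ℝ), Tendsto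
        (fun N => 𝔼 k ∈ Finset.Ico (a N) (b N), Λ (φ * h.comp (T k)))
        (hyperfilter ℕ : Ultrafilter ℕ) (𝓝 (ultraLim (hyperfilter ℕ : Ultrafilter ℕ) fun N =>
          𝔼 k ∈ Finset.Ico (a N) (b N), Λ (φ * h.comp (T k)))) := fun h φ =>
      tendsto_ultraLim _ fun N => abs_expect_le_of_abs_le (by positivity) fun k => hbd h φ k
    set Λ₁ : C(X, ℝ) → ℝ := fun φ => (Λ h)⁻¹ * ultraLim (hyperfilter ℕ : Ultrafilter ℕ) fun N =>
      𝔼 k ∈ Finset.Ico (a N) (b N), Λ (φ * h.comp (T k)) with hΛ₁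
    set Λ₂ : C(X, ℝ) → ℝ := fun φ => (Λ (1 - h))⁻¹ *
      ultraLim (hyperfilter ℕ : Ultrafilter ℕ) fun N =>
        𝔼 k ∈ Finset.Ico (a N) (b N), Λ (φ * (1 - h).comp (T k)) with hΛ₂
    have hcomb : ∀ φ, Λ φ = Λ h * Λ₁ φ + (1 - Λ h) * Λ₂ φ := by
      intro φ
      simp only [hΛ₁, hΛ₂]
      rw [hc, mul_inv_cancel_left₀ (by linarith), mul_inv_cancel_left₀ (by linarith)]
      refine tendsto_nhds_unique ?_ ((hl h φ).add (hl (1 - h) φ))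
      refine tendsto_const_nhds.congr fun N => ?_
      rw [← Finset.expect_add_distrib]
      have : ∀ k, Λ (φ * h.comp (T k)) + Λ (φ * (1 - h).comp (T k)) = Λ φ := fun k => by
        rw [← hΛ.map_add]
        congr 1
        ext x
        simp
        ring
      simp_rw [this]
      rw [Finset.expect_const (Finset.nonempty_Ico.2 (hlt N))]
    have e := hcomb f
    have e1 := hle _ m1
    have e2 := hle _ m2
    have s1 : Λ₁ ∈ S := ⟨m1, by change δ ≤ Λ₁ f; nlinarith⟩
    have s2 : Λ₂ ∈ S := ⟨m2, by change δ ≤ Λ₂ f; nlinarith⟩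
    have heq := hext s1 s2 ⟨Λ h, 1 - Λ h, by linarith, by linarith, by ring, by
      ext φ
      simp [hcomb φ]⟩
    have hg : Λ₁ g = Λ g := congrFun heq g
    have := hl h g
    have hg' : ultraLim (hyperfilter ℕ : Ultrafilter ℕ) (fun N =>
        𝔼 k ∈ Finset.Ico (a N) (b N), Λ (g * h.comp (T k))) = Λ g * Λ h := by
      rw [← hg, hΛ₁]
      field_simp
    rwa [hg'] at this
  have hmid : ∀ (g h : C(X, ℝ)), (∀ x, 1 / 4 ≤ h x) → (∀ x, h x ≤ 3 / 4) → ∀ ε > 0,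
      ∃ L : ℕ, ∀ a b : ℤ, a + L ≤ b →
        |𝔼 n ∈ Finset.Ico a b, Λ (g * h.comp (T n)) - Λ g * Λ h| ≤ ε := by
    intro g h h1 h3 ε hε
    by_contra! hcon
    choose a b hab hgt using fun N : ℕ => hcon (N + 1)
    have hab' : ∀ N : ℕ, (N : ℤ) + 1 ≤ b N - a N := fun N => by
      have := hab N
      push_cast at this
      lia
    have ht := hlim g h h1 h3 a b (tendsto_atTop_mono (fun N => by have := hab' N; lia)
      tendsto_natCast_atTop_atTop) (fun N => by have := hab' N; lia)
    obtain ⟨N, hN⟩ := ((tendsto_order.1 ((ht.sub_const (Λ g * Λ h)).abs)).2 ε (by simpa)).exists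
    exact lt_asymm hN (hgt N)
  refine ⟨Λ, hΛ, hΛf, fun g h ε hε => ?_⟩
  set s : ℝ := (4 * (‖h‖ + 1))⁻¹ with hs
  have hs0 : 0 < s := by positivity
  have hsh : ∀ x, |s * h x| ≤ 1 / 4 := fun x => by
    rw [abs_mul, abs_of_pos hs0, hs, inv_mul_le_iff₀ (by positivity)]
    linarith [abs_apply_le_norm h x]
  obtain ⟨L, hL⟩ := hmid g ((1 / 2 : ℝ) • 1 + s • h)
    (fun x => by simp; linarith [(abs_le.1 (hsh x)).1])
    (fun x => by simp; linarith [(abs_le.1 (hsh x)).2]) (s * ε) (by positivity)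
  refine ⟨L + 1, fun a b hab => ?_⟩
  have hlt : a < b := by
    push_cast at hab
    lia
  have h1 := hL a b (by push_cast at hab; lia)
  have h2 : ∀ n, Λ (g * ((1 / 2 : ℝ) • 1 + s • h).comp (T n)) =
      1 / 2 * Λ g + s * Λ (g * h.comp (T n)) := fun n => by
    rw [← hΛ.map_smul, ← hΛ.map_smul, ← hΛ.map_add]
    congr 1
    ext x
    simp
    ring
  simp_rw [h2, Finset.expect_add_distrib, ← Finset.mul_expect] at h1
  rw [Finset.expect_const (Finset.nonempty_Ico.2 hlt), hΛ.map_add, hΛ.map_const, hΛ.map_smul] at h1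
  refine le_of_mul_le_mul_left ?_ hs0
  refine le_trans (le_of_eq ?_) h1
  rw [← abs_of_pos hs0, ← abs_mul, abs_of_pos hs0]
  congr 1
  ring

end OrbitMeans

section OrbitMeasure

variable {X : Type*} [TopologicalSpace X] [CompactSpace X] [T2Space X] [MeasurableSpace X]
  [BorelSpace X] {T : ℤ → C(X, X)} {ω : X} {Λ : C(X, ℝ) → ℝ}

lemma IsOrbitMean.exists_measure (hΛ : IsOrbitMean T ω Λ) :
    ∃ μ : Measure X, IsProbabilityMeasure μ ∧ μ.Regular ∧ ∀ φ : C(X, ℝ), ∫ x, φ x ∂μ = Λ φ := by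
  let Ψ : CompactlySupportedContinuousMap X ℝ →ₚ[ℝ] ℝ := PositiveLinearMap.mk₀
    { toFun := fun φ => Λ φ.toContinuousMap
      map_add' := fun φ ψ => hΛ.map_add _ _
      map_smul' := fun c φ => hΛ.map_smul c _ } fun φ h => hΛ.nonneg _ fun k => h _
  have hΨ : ∀ φ : C(X, ℝ), ∫ x, φ x ∂(RealRMK.rieszMeasure Ψ) = Λ φ := fun φ =>
    RealRMK.integral_rieszMeasure Ψ ⟨φ, HasCompactSupport.of_compactSpace _⟩
  refine ⟨RealRMK.rieszMeasure Ψ, ⟨?_⟩, inferInstance, hΨ⟩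
  have h1 := hΨ 1
  rw [hΛ.map_one] at h1
  simp only [ContinuousMap.one_apply, integral_const, smul_eq_mul, mul_one] at h1
  rw [Measure.real, ENNReal.toReal_eq_one_iff] at h1
  exact h1

/-- Ergodicity of a measure can be tested on continuous functions. -/
lemma isErgodicFlow_of_isOrbitMean [HasOuterApproxClosed X] (hT : IsContinuousFlow T)
    (hΛ : IsOrbitMean T ω Λ)
    (herg : ∀ g h : C(X, ℝ), ∀ ε > 0, ∃ L : ℕ, ∀ a b : ℤ, a + L ≤ b →
      |𝔼 n ∈ Finset.Ico a b, Λ (g * h.comp (T n)) - Λ g * Λ h| ≤ ε)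
    {μ : Measure X} [IsProbabilityMeasure μ] [μ.Regular] (hμ : ∀ φ : C(X, ℝ), ∫ x, φ x ∂μ = Λ φ) :
    IsErgodicFlow μ fun n => T n := by
  have hm : ∀ n, Measurable (T n) := fun n => (T n).continuous.measurable
  have hmp : ∀ n, MeasurePreserving (T n) μ μ := by
    refine fun n => ⟨hm n, ?_⟩
    have : IsFiniteMeasure (μ.map (T n)) := Measure.isFiniteMeasure_map μ _
    refine ext_of_forall_integral_eq_of_IsFiniteMeasure fun φ => ?_
    rw [integral_map (hm n).aemeasurable φ.continuous.measurable.aestronglyMeasurable]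
    exact (hμ (φ.toContinuousMap.comp (T n))).trans ((hΛ.map_comp n _).trans (hμ _).symm)
  have hcomp : ∀ {φ : X → ℝ} (_ : Measurable φ) n, ∫ x, φ (T n x) ∂μ = ∫ x, φ x ∂μ := by
    intro φ hφ n
    conv_rhs => rw [← (hmp n).map_eq]
    rw [integral_map (hm n).aemeasurable hφ.aestronglyMeasurable]
  refine ⟨hmp, hT.add_apply, hT.zero_apply, fun g h hg hh bg bh ε hε => ?_⟩
  have hgi := integrable_of_abs_le (μ := μ) hg bg
  have hhi := integrable_of_abs_le (μ := μ) hh bh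
  have hη : 0 < ε / 5 := by positivity
  obtain ⟨g', hg', hgi'⟩ := hgi.exists_boundedContinuous_integral_sub_le hη
  set C := ‖g'‖ + 1 with hC
  have hC0 : 0 < C := by positivity
  have bg' : ∀ x, |g' x| ≤ C := fun x => (g'.norm_coe_le_norm x).trans (by simp [hC])
  obtain ⟨h', hh', hhi'⟩ := hhi.exists_boundedContinuous_integral_sub_le (div_pos hη hC0)
  simp only [Real.norm_eq_abs] at hg' hh'
  have hgm' : Measurable g' := g'.continuous.measurable
  have hhm' : Measurable h' := h'.continuous.measurable
  obtain ⟨L, hL⟩ := herg g'.toContinuousMap h'.toContinuousMap (ε / 5) hη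
  refine ⟨L, fun a b hab => ?_⟩
  have k0 : |𝔼 n ∈ Finset.Ico a b, ∫ x, g' x * h' (T n x) ∂μ -
      (∫ x, g' x ∂μ) * ∫ x, h' x ∂μ| ≤ ε / 5 := by
    have e1 : ∀ n, ∫ x, g' x * h' (T n x) ∂μ =
      Λ (g'.toContinuousMap * h'.toContinuousMap.comp (T n)) := fun n =>
      hμ (g'.toContinuousMap * h'.toContinuousMap.comp (T n))
    have e2 : ∫ x, g' x ∂μ = Λ g'.toContinuousMap := hμ g'.toContinuousMap
    have e3 : ∫ x, h' x ∂μ = Λ h'.toContinuousMap := hμ h'.toContinuousMap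
    simp_rw [e1]
    rw [e2, e3]
    exact hL a b hab
  have k1 : ∀ n, |∫ x, g x * h (T n x) ∂μ - ∫ x, g' x * h (T n x) ∂μ| ≤ ε / 5 := fun n => by
    simpa using abs_integral_mul_sub_integral_mul_le hgi hgi' (hh.comp (hm n)) (C := 1)
      (fun x => bh _) hg' zero_le_one
  have hCη : C * (ε / 5 / C) = ε / 5 := by field_simp
  have k2 : ∀ n, |∫ x, g' x * h (T n x) ∂μ - ∫ x, g' x * h' (T n x) ∂μ| ≤ ε / 5 := fun n => by
    have h1 : ∫ x, |h (T n x) - h' (T n x)| ∂μ ≤ ε / 5 / C :=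
      (hcomp (φ := fun x => |h x - h' x|) (continuous_abs.measurable.comp (hh.sub hhm')) n).trans_le
        hh'
    have := abs_integral_mul_sub_integral_mul_le ((hmp n).integrable_comp_of_integrable hhi)
      ((hmp n).integrable_comp_of_integrable hhi') hgm' bg' h1 hC0.le
    rw [hCη] at this
    simpa only [mul_comm, Function.comp_apply] using this
  have habs : ∀ {φ ψ : X → ℝ}, Integrable φ μ → Integrable ψ μ →
      |∫ x, φ x ∂μ - ∫ x, ψ x ∂μ| ≤ ∫ x, |φ x - ψ x| ∂μ := fun hφ hψ => by
    rw [← integral_sub hφ hψ]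
    exact abs_integral_le_integral_abs
  have habs1 : ∀ {φ : X → ℝ} {C : ℝ}, Measurable φ → (∀ x, |φ x| ≤ C) → |∫ x, φ x ∂μ| ≤ C :=
    fun {φ C} hφ b => by
      refine abs_integral_le_integral_abs.trans ?_
      simpa using integral_mono (integrable_of_abs_le (μ := μ) hφ b).abs
        (integrable_const (μ := μ) C) b
  have k3 : |(∫ x, g' x ∂μ - ∫ x, g x ∂μ) * ∫ x, h x ∂μ| ≤ ε / 5 := by
    rw [abs_mul, abs_sub_comm]
    refine (mul_le_of_le_one_right (abs_nonneg _) (habs1 hh bh)).trans ((habs hgi hgi').trans hg')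
  have k4 : |(∫ x, g' x ∂μ) * (∫ x, h' x ∂μ - ∫ x, h x ∂μ)| ≤ ε / 5 := by
    rw [abs_mul, abs_sub_comm, ← hCη]
    exact mul_le_mul (habs1 hgm' bg') ((habs hhi hhi').trans hh') (abs_nonneg _) hC0.le
  have k5 := abs_expect_sub_expect_le (s := Finset.Ico a b) hη.le k1
  have k6 := abs_expect_sub_expect_le (s := Finset.Ico a b) hη.le k2
  rw [abs_le] at k0 k3 k4 k5 k6 ⊢
  constructor <;> linarith [k0.1, k0.2, k3.1, k3.2, k4.1, k4.2, k5.1, k5.2, k6.1, k6.2]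

end OrbitMeasure

section BanachDensity

/-- The set of densities of `B` on intervals of length at least `L`. -/
def intervalDensities (B : Set ℤ) (L : ℕ) : Set ℝ :=
  {r : ℝ | ∃ M N : ℤ, (L : ℤ) ≤ N - M ∧
    r = ((B ∩ Set.Ico M N).ncard : ℝ) / ((N : ℝ) - (M : ℝ))}

lemma density_eq_expect (B : Set ℤ) {φ : ℤ → ℝ} (h0 : ∀ k ∉ B, φ k = 0) (h1 : ∀ k ∈ B, φ k = 1)
    {a b : ℤ} (hab : a ≤ b) :
    ((B ∩ Set.Ico a b).ncard : ℝ) / ((b : ℝ) - a) = 𝔼 k ∈ Finset.Ico a b, φ k := by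
  classical
  have hφ : φ = fun k => if k ∈ B then 1 else 0 := by
    ext k
    split_ifs with h
    · exact h1 k h
    · exact h0 k h
  have hset : B ∩ Set.Ico a b = ((Finset.Ico a b).filter (· ∈ B) : Finset ℤ) := by
    ext k
    simp [and_comm]
  have hcard : (((b - a).toNat : ℕ) : ℝ) = (b : ℝ) - a := by
    have : (((b - a).toNat : ℤ) : ℝ) = ((b - a : ℤ) : ℝ) := by
      rw [Int.toNat_of_nonneg (by lia)]
    push_cast at this
    exact this
  rw [Finset.expect_eq_sum_div_card, Int.card_Ico, hcard, hset, Set.ncard_coe_finset, hφ]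
  simp

lemma nonneg_of_mem_intervalDensities {B : Set ℤ} {L : ℕ} {r : ℝ}
    (hr : r ∈ intervalDensities B L) : 0 ≤ r := by
  obtain ⟨M, N, h, rfl⟩ := hr
  have : (M : ℝ) ≤ N := by exact_mod_cast (by lia : M ≤ N)
  exact div_nonneg (Nat.cast_nonneg _) (by linarith)

lemma bddAbove_intervalDensities (B : Set ℤ) (L : ℕ) : BddAbove (intervalDensities B L) := by
  classical
  refine ⟨1, ?_⟩
  rintro _ ⟨M, N, h, rfl⟩
  rw [density_eq_expect B (φ := fun k => if k ∈ B then 1 else 0) (by simp +contextual)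
    (by simp +contextual) (by lia)]
  refine (abs_le.1 (abs_expect_le_of_abs_le zero_le_one fun k => ?_)).2
  split_ifs <;> simp

lemma nonempty_intervalDensities (B : Set ℤ) (L : ℕ) : (intervalDensities B L).Nonempty :=
  ⟨_, 0, L, by simp, rfl⟩

lemma sSup_intervalDensities_nonneg (B : Set ℤ) (L : ℕ) : 0 ≤ sSup (intervalDensities B L) :=
  Real.sSup_nonneg fun _ => nonneg_of_mem_intervalDensities

lemma upperBanachDensity_nonneg (B : Set ℤ) : 0 ≤ upperBanachDensity B :=
  Real.iInf_nonneg fun L => sSup_intervalDensities_nonneg B L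

variable {X : Type*} [TopologicalSpace X] {T : ℤ → C(X, X)} {ω : X} {Λ : C(X, ℝ) → ℝ}

lemma IsOrbitMean.le_upperBanachDensity (hT : IsContinuousFlow T) (hΛ : IsOrbitMean T ω Λ)
    {B : Set ℤ} {φ : C(X, ℝ)} (h0 : ∀ k ∉ B, φ (T k ω) = 0) (h1 : ∀ k ∈ B, φ (T k ω) = 1) :
    Λ φ ≤ upperBanachDensity B := by
  refine le_ciInf fun L => ?_
  have hne : (Finset.Ico (0 : ℤ) (L + 1)).Nonempty := Finset.nonempty_Ico.2 (by lia)
  set c : ℝ := ((Finset.Ico (0 : ℤ) (L + 1)).card : ℝ) with hc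
  have hc0 : c ≠ 0 := by
    rw [hc, Nat.cast_ne_zero]
    exact hne.card_pos.ne'
  have havg : Λ φ = Λ (c⁻¹ • ∑ n ∈ Finset.Ico (0 : ℤ) (L + 1), φ.comp (T n)) := by
    rw [hΛ.map_smul, hΛ.map_sum]
    simp_rw [hΛ.map_comp]
    rw [Finset.sum_const, nsmul_eq_mul, inv_mul_cancel_left₀ hc0]
  rw [havg]
  refine hΛ.le_of_forall_le fun k => ?_
  refine le_csSup (bddAbove_intervalDensities B L) ⟨k, k + (L + 1), by lia, ?_⟩
  rw [density_eq_expect B h0 h1 (by lia)]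
  have := expect_Ico_comp_sub (fun j => φ (T j (T k ω))) k (k + (L + 1)) k
  rw [sub_self, add_sub_cancel_left] at this
  simp only [← hT.add_apply, sub_add_cancel] at this
  rw [this, Finset.expect_eq_sum_div_card, ← hc]
  simp [hT.add_apply, div_eq_inv_mul]

lemma exists_isOrbitMean_ge [CompactSpace X] (hT : IsContinuousFlow T) {B : Set ℤ}
    {φ : C(X, ℝ)} (h0 : ∀ k ∉ B, φ (T k ω) = 0) (h1 : ∀ k ∈ B, φ (T k ω) = 1) :
    ∃ Λ, IsOrbitMean T ω Λ ∧ upperBanachDensity B ≤ Λ φ := by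
  have hex : ∀ N : ℕ, ∃ a b : ℤ, ((N + 1 : ℕ) : ℤ) ≤ b - a ∧
      upperBanachDensity B - 1 / ((N : ℝ) + 1) ≤ 𝔼 k ∈ Finset.Ico a b, φ (T k ω) := by
    intro N
    have hle : upperBanachDensity B ≤ sSup (intervalDensities B (N + 1)) :=
      ciInf_le ⟨0, by rintro _ ⟨L, rfl⟩; exact sSup_intervalDensities_nonneg B L⟩ (N + 1)
    obtain ⟨r, ⟨a, b, hab, rfl⟩, hr⟩ := exists_lt_of_lt_csSup (nonempty_intervalDensities B (N + 1))
      ((sub_lt_self _ (by positivity : (0 : ℝ) < 1 / ((N : ℝ) + 1))).trans_le hle)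
    rw [density_eq_expect B h0 h1 (by lia)] at hr
    exact ⟨a, b, hab, hr.le⟩
  choose a b hab hr using hex
  have hab' : ∀ N : ℕ, (N : ℤ) + 1 ≤ b N - a N := fun N => by
    have := hab N
    push_cast at this
    lia
  refine ⟨_, isOrbitMean_ultraLim hT ω (a := a) (b := b)
    (tendsto_atTop_mono (fun N => by have := hab' N; lia) tendsto_natCast_atTop_atTop)
    (fun N => by have := hab' N; lia), ?_⟩
  have ht := tendsto_ultraLim (hyperfilter ℕ : Ultrafilter ℕ)
    (x := fun N => 𝔼 k ∈ Finset.Ico (a N) (b N), φ (T k ω)) (C := ‖φ‖)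
    fun N => abs_expect_le_of_abs_le (norm_nonneg φ) fun k => abs_apply_le_norm φ _
  have hl : Tendsto (fun N : ℕ => upperBanachDensity B - 1 / ((N : ℝ) + 1))
      (hyperfilter ℕ : Ultrafilter ℕ) (𝓝 (upperBanachDensity B)) := by
    simpa using (tendsto_one_div_add_atTop_nhds_zero_nat.const_sub
      (upperBanachDensity B)).mono_left Nat.hyperfilter_le_atTop
  exact le_of_tendsto_of_tendsto' hl ht hr

/-- The shift on two-sided binary sequences. -/
def binaryShift (n : ℤ) : C(ℤ → Bool, ℤ → Bool) where
  toFun x k := x (k + n)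
  continuous_toFun := by fun_prop

lemma binaryShift_apply (n : ℤ) (x : ℤ → Bool) (k : ℤ) : binaryShift n x k = x (k + n) := rfl

lemma isContinuousFlow_binaryShift : IsContinuousFlow binaryShift where
  zero_apply x := by
    ext k
    simp [binaryShift_apply]
  add_apply a b x := by
    ext k
    rw [binaryShift_apply, binaryShift_apply, binaryShift_apply, add_assoc]

/-- The indicator of the cylinder of sequences with value `true` at the origin. -/
def zeroCylinder : C(ℤ → Bool, ℝ) where
  toFun x := if x 0 then 1 else 0
  continuous_toFun := by
    have h : Continuous fun t : Bool => if t then (1 : ℝ) else 0 := continuous_of_discreteTopology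
    exact h.comp (continuous_apply 0)

lemma zeroCylinder_binaryShift (n : ℤ) (x : ℤ → Bool) :
    zeroCylinder (binaryShift n x) = if x n then 1 else 0 := by
  simp [zeroCylinder, binaryShift_apply]

end BanachDensity

/-- If `A ⊆ ℤ` has upper Banach density `δ`, then for every `ε > 0` the set
of pairs `(n,m)` with `d*(A ∩ (A−n) ∩ (A−m) ∩ (A−n−m)) > δ⁴ − ε` is syndetic in `ℤ²`. -/
theorem syndetic_banach_density_combinations
    (A : Set ℤ) (δ : ℝ) (hδ : upperBanachDensity A = δ) :
    ∀ ε : ℝ, 0 < ε →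
      SyndeticZ2 {p : ℤ × ℤ |
        δ ^ 4 - ε < upperBanachDensity
          (A ∩ {x : ℤ | x + p.1 ∈ A} ∩ {x : ℤ | x + p.2 ∈ A}
            ∩ {x : ℤ | x + p.1 + p.2 ∈ A})} := by
  classical
  intro ε hε
  have hT := isContinuousFlow_binaryShift
  let ω : ℤ → Bool := fun k => decide (k ∈ A)
  have hω0 : ∀ k ∉ A, zeroCylinder (binaryShift k ω) = 0 := fun k hk => by
    simp [zeroCylinder_binaryShift, ω, hk]
  have hω1 : ∀ k ∈ A, zeroCylinder (binaryShift k ω) = 1 := fun k hk => by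
    simp [zeroCylinder_binaryShift, ω, hk]
  obtain ⟨Λ, hΛ, hΛA, herg⟩ := exists_ergodic_isOrbitMean hT
    (fun Λ hΛ => IsOrbitMean.le_upperBanachDensity hT hΛ hω0 hω1)
    (exists_isOrbitMean_ge hT hω0 hω1)
  obtain ⟨μ, hμp, hμr, hμ⟩ := hΛ.exists_measure
  have hflow := isErgodicFlow_of_isOrbitMean hT hΛ herg hμ
  obtain ⟨L, hL, hmeet⟩ := hflow.exists_lt_cubeCorrelation
    zeroCylinder.continuous.measurable
    (fun x => by simp only [zeroCylinder, ContinuousMap.coe_mk]; split_ifs <;> simp)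
    (fun x => by simp only [zeroCylinder, ContinuousMap.coe_mk]; split_ifs <;> simp) hε
  refine ⟨L, hL, fun a b => ?_⟩
  obtain ⟨n, m, h1, h2, h3, h4, hnm⟩ := hmeet a b
  refine ⟨n, m, h1, h2, h3, h4, ?_⟩
  rw [Set.mem_ofPred_eq]
  have hδ0 : 0 ≤ δ := hδ ▸ upperBanachDensity_nonneg A
  have hpow : δ ^ 4 ≤ (∫ x, zeroCylinder x ∂μ) ^ 4 := by
    rw [hμ]
    exact pow_le_pow_left₀ hδ0 (hδ ▸ hΛA) 4
  let φ : C(ℤ → Bool, ℝ) := zeroCylinder * zeroCylinder.comp (binaryShift n) *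
    zeroCylinder.comp (binaryShift m) * zeroCylinder.comp (binaryShift (n + m))
  have hφ : ∀ k, φ (binaryShift k ω) = (if k ∈ A then 1 else 0) * (if k + n ∈ A then 1 else 0) *
      (if k + m ∈ A then 1 else 0) * (if k + n + m ∈ A then 1 else 0) := fun k => by
    simp only [φ, ContinuousMap.mul_apply, ContinuousMap.comp_apply, ← hT.add_apply,
      zeroCylinder_binaryShift, ω, decide_eq_true_eq]
    rw [add_comm n k, add_comm m k, add_comm (n + m) k, add_assoc k n m]
  have hcorr : cubeCorrelation μ (fun n => binaryShift n) zeroCylinder zeroCylinder zeroCylinder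
      zeroCylinder n m = Λ φ := hμ φ
  have hle := hΛ.le_upperBanachDensity hT (φ := φ)
    (B := A ∩ {x : ℤ | x + n ∈ A} ∩ {x : ℤ | x + m ∈ A} ∩ {x : ℤ | x + n + m ∈ A})
    (fun k hk => by
      rw [hφ]
      simp only [Set.mem_inter_iff, Set.mem_ofPred_eq] at hk
      split_ifs <;> simp_all)
    (fun k hk => by
      rw [hφ]
      simp only [Set.mem_inter_iff, Set.mem_ofPred_eq] at hk
      simp [hk])
  change δ ^ 4 - ε < upperBanachDensity
    (A ∩ {x : ℤ | x + n ∈ A} ∩ {x : ℤ | x + m ∈ A} ∩ {x : ℤ | x + n + m ∈ A})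
  linarith
end

section
/- Let G be a countable group, (X, B, μ) a standard probability space, and T, S commuting measure-preserving actions of G on X. Suppose f ∈ L^∞(μ) is nonnegative. Then for all two-sided Følner sequences Φ, Ψ in G, lim_{n→∞} (1/(|Φ_n||Ψ_n|)) Σ_{(g,h) ∈ Φ_n × Ψ_n} ∫ f · (f∘T_g) · (f∘S_h) · (f∘T_g∘S_h) dμ exists and is at least (∫ f dμ)⁴. -/
open MeasureTheory Filter

/-- `Φ` is a left Følner sequence in `Γ`: a sequence of nonempty finite subsets with
`|Φₙ ∩ γΦₙ|/|Φₙ| → 1` for every `γ`. -/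
def IsLeftFolner {Γ : Type*} [Group Γ] [DecidableEq Γ] (Φ : ℕ → Finset Γ) : Prop :=
  (∀ n, (Φ n).Nonempty) ∧
    ∀ γ : Γ, Filter.Tendsto
      (fun n => ((Φ n ∩ (Φ n).image (γ * ·)).card : ℝ) / ((Φ n).card : ℝ))
      Filter.atTop (nhds 1)

/-- `Φ` is a two-sided Følner sequence: a left Følner sequence with additionally
`|Φₙ ∩ Φₙγ|/|Φₙ| → 1` for every `γ`. -/
def IsTwoSidedFolner {Γ : Type*} [Group Γ] [DecidableEq Γ] (Φ : ℕ → Finset Γ) : Prop :=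
  IsLeftFolner Φ ∧
    ∀ γ : Γ, Filter.Tendsto
      (fun n => ((Φ n ∩ (Φ n).image (· * γ)).card : ℝ) / ((Φ n).card : ℝ))
      Filter.atTop (nhds 1)

open scoped BigOperators

section QuadForm

variable {ι κ : Type*}

/-- The four-linear form on finitely supported weights with kernel `c`. -/
noncomputable def quadForm (c : ι → ι → κ → κ → ℝ) :
    (ι →₀ ℝ) →ₗ[ℝ] (ι →₀ ℝ) →ₗ[ℝ] (κ →₀ ℝ) →ₗ[ℝ] (κ →₀ ℝ) →ₗ[ℝ] ℝ :=
  Finsupp.linearCombination ℝ fun k => Finsupp.linearCombination ℝ fun k' =>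
    Finsupp.linearCombination ℝ fun j => Finsupp.linearCombination ℝ fun j' => c k k' j j'

lemma quadForm_apply (c : ι → ι → κ → κ → ℝ) (p p' : ι →₀ ℝ) (q q' : κ →₀ ℝ) :
    quadForm c p p' q q' = ∑ k ∈ p.support, ∑ k' ∈ p'.support, ∑ j ∈ q.support,
      ∑ j' ∈ q'.support, p k * (p' k' * (q j * (q' j' * c k k' j j'))) := by
  simp [quadForm, Finsupp.linearCombination_apply, Finsupp.sum, LinearMap.sum_apply,
    Finset.mul_sum]

lemma quadForm_symm_left {c : ι → ι → κ → κ → ℝ} (hc : ∀ k k' j j', c k k' j j' = c k' k j j')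
    (p p' : ι →₀ ℝ) (q q' : κ →₀ ℝ) : quadForm c p p' q q' = quadForm c p' p q q' := by
  rw [quadForm_apply, quadForm_apply, Finset.sum_comm]
  refine Finset.sum_congr rfl fun k _ => Finset.sum_congr rfl fun k' _ =>
    Finset.sum_congr rfl fun j _ => Finset.sum_congr rfl fun j' _ => ?_
  rw [hc]
  ring

lemma quadForm_symm_right {c : ι → ι → κ → κ → ℝ} (hc : ∀ k k' j j', c k k' j j' = c k k' j' j)
    (p p' : ι →₀ ℝ) (q q' : κ →₀ ℝ) : quadForm c p p' q q' = quadForm c p p' q' q := by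
  rw [quadForm_apply, quadForm_apply]
  refine Finset.sum_congr rfl fun k _ => Finset.sum_congr rfl fun k' _ => ?_
  rw [Finset.sum_comm]
  refine Finset.sum_congr rfl fun j _ => Finset.sum_congr rfl fun j' _ => ?_
  rw [hc]
  ring

lemma quadForm_mapDomain {ι' κ' : Type*} (c : ι' → ι' → κ' → κ' → ℝ) (a a' : ι → ι')
    (b b' : κ → κ') (p p' : ι →₀ ℝ) (q q' : κ →₀ ℝ) :
    quadForm c (p.mapDomain a) (p'.mapDomain a') (q.mapDomain b) (q'.mapDomain b') =
      quadForm (fun k k' j j' => c (a k) (a' k') (b j) (b' j')) p p' q q' := by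
  induction p using Finsupp.induction_linear with
  | zero => simp
  | add _ _ h h' => simp [Finsupp.mapDomain_add, h, h']
  | single k x =>
  induction p' using Finsupp.induction_linear with
  | zero => simp
  | add _ _ h h' => simp only [Finsupp.mapDomain_add, map_add, LinearMap.add_apply, h, h']
  | single k' x' =>
  induction q using Finsupp.induction_linear with
  | zero => simp
  | add _ _ h h' => simp only [Finsupp.mapDomain_add, map_add, LinearMap.add_apply, h, h']
  | single j y =>
  induction q' using Finsupp.induction_linear with
  | zero => simp
  | add _ _ h h' => simp only [Finsupp.mapDomain_add, map_add, h, h']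
  | single j' y' => simp [quadForm]

/-- The rectangle kernel of a matrix. -/
def rectKernel (M : ι → κ → ℝ) (k k' : ι) (j j' : κ) : ℝ :=
  M k j * M k' j * M k j' * M k' j'

lemma quadForm_rectKernel_eq_sum_sq (M : ι → κ → ℝ) (p : ι →₀ ℝ) (q q' : κ →₀ ℝ) :
    quadForm (rectKernel M) p p q q' = ∑ j ∈ q.support, q j * ∑ j' ∈ q'.support, q' j' *
      (∑ k ∈ p.support, p k * (M k j * M k j')) ^ 2 := by
  have h : ∀ k ∈ p.support, ∑ k' ∈ p.support, ∑ j ∈ q.support,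
      ∑ j' ∈ q'.support, p k * (p k' * (q j * (q' j' * rectKernel M k k' j j'))) =
      ∑ j ∈ q.support, ∑ j' ∈ q'.support, ∑ k' ∈ p.support,
        p k * (p k' * (q j * (q' j' * rectKernel M k k' j j'))) := fun k _ => by
    rw [Finset.sum_comm]
    exact Finset.sum_congr rfl fun j _ => Finset.sum_comm
  rw [quadForm_apply, Finset.sum_congr rfl h, Finset.sum_comm]
  refine Finset.sum_congr rfl fun j _ => ?_
  rw [Finset.sum_comm, Finset.mul_sum]
  refine Finset.sum_congr rfl fun j' _ => ?_
  rw [sq, Finset.sum_mul_sum]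
  simp only [Finset.mul_sum]
  refine Finset.sum_congr rfl fun k _ => Finset.sum_congr rfl fun k' _ => ?_
  rw [rectKernel]
  ring

lemma quadForm_rectKernel_swap (M : ι → κ → ℝ) (p p' : ι →₀ ℝ) (q q' : κ →₀ ℝ) :
    quadForm (rectKernel M) p p' q q' = quadForm (rectKernel fun j k => M k j) q q' p p' := by
  rw [quadForm_apply, quadForm_apply]
  have h : ∀ k ∈ p.support, ∑ k' ∈ p'.support, ∑ j ∈ q.support,
      ∑ j' ∈ q'.support, p k * (p' k' * (q j * (q' j' * rectKernel M k k' j j'))) =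
      ∑ j ∈ q.support, ∑ j' ∈ q'.support, ∑ k' ∈ p'.support,
        p k * (p' k' * (q j * (q' j' * rectKernel M k k' j j'))) := fun k _ => by
    rw [Finset.sum_comm]
    exact Finset.sum_congr rfl fun j _ => Finset.sum_comm
  rw [Finset.sum_congr rfl h, Finset.sum_comm]
  refine Finset.sum_congr rfl fun j _ => ?_
  rw [Finset.sum_comm]
  refine Finset.sum_congr rfl fun j' _ => Finset.sum_congr rfl fun k _ =>
    Finset.sum_congr rfl fun k' _ => ?_
  simp only [rectKernel]
  ring

lemma quadForm_rectKernel_nonneg (M : ι → κ → ℝ) (v : ι →₀ ℝ) {q : κ →₀ ℝ} (hq : ∀ j, 0 ≤ q j) :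
    0 ≤ quadForm (rectKernel M) v v q q := by
  rw [quadForm_rectKernel_eq_sum_sq]
  exact Finset.sum_nonneg fun j _ => mul_nonneg (hq j) <| Finset.sum_nonneg fun j' _ =>
    mul_nonneg (hq j') (sq_nonneg _)

/-- Finitely supported probability weights. -/
def probWeights (ι : Type*) : Set (ι →₀ ℝ) :=
  {p | (∀ i, 0 ≤ p i) ∧ ∑ i ∈ p.support, p i = 1}

lemma sum_pow_two_le_of_mem_probWeights {p : ι →₀ ℝ} (hp : p ∈ probWeights ι) (z : ι → ℝ) :
    (∑ i ∈ p.support, p i * z i) ^ 2 ≤ ∑ i ∈ p.support, p i * z i ^ 2 :=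
  Real.pow_arith_mean_le_arith_mean_pow_of_even _ _ _ (fun i _ => hp.1 i) hp.2 even_two

lemma pow_four_le_quadForm_rectKernel (M : ι → κ → ℝ) {p : ι →₀ ℝ} (hp : p ∈ probWeights ι)
    {q : κ →₀ ℝ} (hq : q ∈ probWeights κ) :
    (∑ k ∈ p.support, p k * ∑ j ∈ q.support, q j * M k j) ^ 4 ≤
      quadForm (rectKernel M) p p q q := by
  have h1 : (∑ k ∈ p.support, p k * ∑ j ∈ q.support, q j * M k j) ^ 2 ≤
      ∑ k ∈ p.support, p k * (∑ j ∈ q.support, q j * M k j) ^ 2 :=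
    sum_pow_two_le_of_mem_probWeights hp _
  have h2 : ∑ k ∈ p.support, p k * (∑ j ∈ q.support, q j * M k j) ^ 2 =
      ∑ j ∈ q.support, q j * ∑ j' ∈ q.support, q j' *
        ∑ k ∈ p.support, p k * (M k j * M k j') := by
    simp_rw [sq (∑ j ∈ q.support, q j * M _ j), Finset.sum_mul_sum, Finset.mul_sum]
    rw [Finset.sum_comm]
    refine Finset.sum_congr rfl fun j _ => ?_
    rw [Finset.sum_comm]
    refine Finset.sum_congr rfl fun j' _ => Finset.sum_congr rfl fun k _ => ?_
    ring
  calc (∑ k ∈ p.support, p k * ∑ j ∈ q.support, q j * M k j) ^ 4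
      = ((∑ k ∈ p.support, p k * ∑ j ∈ q.support, q j * M k j) ^ 2) ^ 2 := by ring
    _ ≤ (∑ j ∈ q.support, q j * ∑ j' ∈ q.support, q j' *
        ∑ k ∈ p.support, p k * (M k j * M k j')) ^ 2 := by
      rw [← h2]
      exact pow_le_pow_left₀ (sq_nonneg _) h1 2
    _ ≤ ∑ j ∈ q.support, q j * (∑ j' ∈ q.support, q j' *
        ∑ k ∈ p.support, p k * (M k j * M k j')) ^ 2 := sum_pow_two_le_of_mem_probWeights hq _
    _ ≤ quadForm (rectKernel M) p p q q := by
      rw [quadForm_rectKernel_eq_sum_sq]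
      exact Finset.sum_le_sum fun j _ => mul_le_mul_of_nonneg_left
        (sum_pow_two_le_of_mem_probWeights hq _) (hq.1 j)

lemma mem_probWeights_iff {p : ι →₀ ℝ} :
    p ∈ probWeights ι ↔ (∀ i, 0 ≤ p i) ∧ Finsupp.linearCombination ℝ (fun _ => (1 : ℝ)) p = 1 := by
  simp [probWeights, Finsupp.linearCombination_apply, Finsupp.sum]

lemma single_mem_probWeights (i : ι) : Finsupp.single i (1 : ℝ) ∈ probWeights ι := by
  refine mem_probWeights_iff.2 ⟨fun k => ?_, by simp⟩
  classical
  rw [Finsupp.single_apply]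
  split_ifs <;> norm_num

lemma midpoint_mem_probWeights {p p' : ι →₀ ℝ} (hp : p ∈ probWeights ι)
    (hp' : p' ∈ probWeights ι) : (1 / 2 : ℝ) • (p + p') ∈ probWeights ι := by
  rw [mem_probWeights_iff] at *
  refine ⟨fun i => ?_, ?_⟩
  · have := hp.1 i
    have := hp'.1 i
    simp only [Finsupp.smul_apply, Finsupp.add_apply, smul_eq_mul]
    positivity
  · rw [map_smul, map_add, hp.2, hp'.2]
    norm_num

lemma mapDomain_mem_probWeights {p : ι →₀ ℝ} (hp : p ∈ probWeights ι) (a : ι → κ) :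
    p.mapDomain a ∈ probWeights κ := by
  rw [mem_probWeights_iff] at *
  refine ⟨fun i => ?_, by rw [Finsupp.linearCombination_mapDomain]; exact hp.2⟩
  classical
  rw [Finsupp.mapDomain, Finsupp.sum_apply]
  refine Finset.sum_nonneg fun k _ => ?_
  simp only [Finsupp.single_apply]
  split_ifs
  exacts [hp.1 k, le_rfl]

end QuadForm

section Polarization

variable {V W : Type*} [AddCommGroup V] [Module ℝ V] [AddCommGroup W] [Module ℝ W]

lemma polarization_of_symm (B : V →ₗ[ℝ] V →ₗ[ℝ] W →ₗ[ℝ] W →ₗ[ℝ] ℝ)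
    (hl : ∀ p p' q q', B p p' q q' = B p' p q q') (hr : ∀ p p' q q', B p p' q q' = B p p' q' q)
    {m p p' : V} {n q q' : W} (hm : m = (1 / 2 : ℝ) • (p + p'))
    (hn : n = (1 / 2 : ℝ) • (q + q')) :
    B p p' q q' = 4 * B m m n n - B m m q q - B m m q' q' - B p p n n - B p' p' n n +
      (B p p q q + B p p q' q' + B p' p' q q + B p' p' q' q') / 4 := by
  subst hm hn
  simp only [map_smul, map_add, LinearMap.smul_apply, LinearMap.add_apply, smul_eq_mul]
  rw [hl p' p, hl p' p, hl p' p, hl p' p, hr _ _ q' q, hr _ _ q' q, hr _ _ q' q]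
  ring

lemma midpoint_le_of_nonneg (B : V →ₗ[ℝ] V →ₗ[ℝ] ℝ) (p p' : V) (h : 0 ≤ B (p - p') (p - p')) :
    B ((1 / 2 : ℝ) • (p + p')) ((1 / 2 : ℝ) • (p + p')) ≤ (B p p + B p' p') / 2 := by
  simp only [map_smul, map_add, map_sub, LinearMap.smul_apply, LinearMap.add_apply,
    LinearMap.sub_apply, smul_eq_mul] at *
  linarith

end Polarization

section Kernel

variable {ι κ : Type*}

lemma quadForm_const (r : ℝ) {p p' : ι →₀ ℝ} (hp : p ∈ probWeights ι) (hp' : p' ∈ probWeights ι)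
    {q q' : κ →₀ ℝ} (hq : q ∈ probWeights κ) (hq' : q' ∈ probWeights κ) :
    quadForm (fun _ _ _ _ => r) p p' q q' = r := by
  rw [quadForm_apply]
  simp only [← Finset.mul_sum, ← Finset.sum_mul, hp.2, hp'.2, hq.2, hq'.2, one_mul]

lemma quadForm_sub (c c' : ι → ι → κ → κ → ℝ) (p p' : ι →₀ ℝ) (q q' : κ →₀ ℝ) :
    quadForm (fun k k' j j' => c k k' j j' - c' k k' j j') p p' q q' =
      quadForm c p p' q q' - quadForm c' p p' q q' := by
  simp only [quadForm_apply, mul_sub, Finset.sum_sub_distrib]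

lemma tendsto_quadForm_zero {c : ℕ → ι → ι → κ → κ → ℝ}
    (hc : ∀ k k' j j', Tendsto (fun n => c n k k' j j') atTop (nhds 0))
    (p p' : ι →₀ ℝ) (q q' : κ →₀ ℝ) :
    Tendsto (fun n => quadForm (c n) p p' q q') atTop (nhds 0) := by
  have h : (0 : ℝ) = ∑ k ∈ p.support, ∑ k' ∈ p'.support, ∑ j ∈ q.support,
      ∑ j' ∈ q'.support, p k * (p' k' * (q j * (q' j' * 0))) := by simp
  rw [h]
  simp only [quadForm_apply]
  exact tendsto_finsetSum _ fun k _ => tendsto_finsetSum _ fun k' _ =>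
    tendsto_finsetSum _ fun j _ => tendsto_finsetSum _ fun j' _ =>
      ((((hc k k' j j').const_mul _).const_mul _).const_mul _).const_mul _

lemma quadForm_expect {α : Type*} (s : Finset α) (c : α → ι → ι → κ → κ → ℝ)
    (p p' : ι →₀ ℝ) (q q' : κ →₀ ℝ) :
    quadForm (fun k k' j j' => 𝔼 a ∈ s, c a k k' j j') p p' q q' =
      𝔼 a ∈ s, quadForm (c a) p p' q q' := by
  simp only [quadForm_apply, Finset.expect_sum_comm, Finset.mul_expect]

variable {X : Type*} [MeasurableSpace X] {μ : Measure X}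

lemma integrable_quadForm {c : X → ι → ι → κ → κ → ℝ}
    (hc : ∀ k k' j j', Integrable (fun x => c x k k' j j') μ)
    (p p' : ι →₀ ℝ) (q q' : κ →₀ ℝ) :
    Integrable (fun x => quadForm (c x) p p' q q') μ := by
  simp only [quadForm_apply]
  exact integrable_finsetSum _ fun k _ => integrable_finsetSum _ fun k' _ =>
    integrable_finsetSum _ fun j _ => integrable_finsetSum _ fun j' _ =>
      ((((hc k k' j j').const_mul _).const_mul _).const_mul _).const_mul _

lemma quadForm_integral {c : X → ι → ι → κ → κ → ℝ}
    (hc : ∀ k k' j j', Integrable (fun x => c x k k' j j') μ)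
    (p p' : ι →₀ ℝ) (q q' : κ →₀ ℝ) :
    quadForm (fun k k' j j' => ∫ x, c x k k' j j' ∂μ) p p' q q' =
      ∫ x, quadForm (c x) p p' q q' ∂μ := by
  have h k k' j j' : Integrable (fun x => p k * (p' k' * (q j * (q' j' * c x k k' j j')))) μ :=
    ((((hc k k' j j').const_mul _).const_mul _).const_mul _).const_mul _
  simp only [quadForm_apply]
  rw [integral_finsetSum _ fun k _ => integrable_finsetSum _ fun k' _ =>
    integrable_finsetSum _ fun j _ => integrable_finsetSum _ fun j' _ => h k k' j j']
  refine Finset.sum_congr rfl fun k _ => ?_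
  rw [integral_finsetSum _ fun k' _ =>
    integrable_finsetSum _ fun j _ => integrable_finsetSum _ fun j' _ => h k k' j j']
  refine Finset.sum_congr rfl fun k' _ => ?_
  rw [integral_finsetSum _ fun j _ => integrable_finsetSum _ fun j' _ => h k k' j j']
  refine Finset.sum_congr rfl fun j _ => ?_
  rw [integral_finsetSum _ fun j' _ => h k k' j j']
  simp only [integral_const_mul]

end Kernel

section Folner

variable {Γ : Type*}

/-- Averages of uniformly bounded functions over `Φ` are asymptotically invariant under `e`. -/
def IsAsympInvariant (Φ : ℕ → Finset Γ) (e : Γ → Γ) : Prop :=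
  ∀ (C : ℝ) (u : ℕ → Γ → ℝ), (∀ n g, |u n g| ≤ C) →
    Tendsto (fun n => 𝔼 g ∈ Φ n, u n (e g) - 𝔼 g ∈ Φ n, u n g) atTop (nhds 0)

lemma IsAsympInvariant.comp {Φ : ℕ → Finset Γ} {e e' : Γ → Γ} (he : IsAsympInvariant Φ e)
    (he' : IsAsympInvariant Φ e') : IsAsympInvariant Φ (e ∘ e') := fun C u hu => by
  simpa using (he' C (fun n g => u n (e g)) fun n g => hu n _).add (he C u hu)

lemma abs_sum_sub_sum_le [DecidableEq Γ] {s t : Finset Γ} (hst : s.card = t.card) {C : ℝ}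
    {u : Γ → ℝ} (hu : ∀ g, |u g| ≤ C) :
    |∑ g ∈ t, u g - ∑ g ∈ s, u g| ≤ 2 * C * (s.card - (s ∩ t).card) := by
  have hle (r : Finset Γ) : |∑ g ∈ r, u g| ≤ C * r.card :=
    (Finset.abs_sum_le_sum_abs _ _).trans <| (Finset.sum_le_sum fun g _ => hu g).trans_eq <| by
      rw [Finset.sum_const, nsmul_eq_mul, mul_comm]
  have hcard (r r' : Finset Γ) : ((r \ r').card : ℝ) = r.card - (r ∩ r').card := by
    rw [eq_sub_iff_add_eq]
    exact_mod_cast Finset.card_sdiff_add_card_inter r r'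
  rw [← Finset.sum_sdiff_sub_sum_sdiff]
  calc |∑ g ∈ t \ s, u g - ∑ g ∈ s \ t, u g| ≤ C * (t \ s).card + C * (s \ t).card :=
        (abs_sub _ _).trans (add_le_add (hle _) (hle _))
    _ = 2 * C * (s.card - (s ∩ t).card) := by
      rw [hcard, hcard, Finset.inter_comm t s, hst]
      ring

lemma isAsympInvariant_of_tendsto [DecidableEq Γ] {Φ : ℕ → Finset Γ}
    (hne : ∀ n, (Φ n).Nonempty) {e : Γ → Γ} (he : Function.Injective e)
    (h : Tendsto (fun n => ((Φ n ∩ (Φ n).image e).card : ℝ) / (Φ n).card) atTop (nhds 1)) :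
    IsAsympInvariant Φ e := fun C u hu => by
  refine squeeze_zero_norm (a := fun n => 2 * C * (1 - ((Φ n ∩ (Φ n).image e).card : ℝ) /
    (Φ n).card)) (fun n => ?_) (by simpa using (h.const_sub 1).const_mul (2 * C))
  have hpos : (0 : ℝ) < (Φ n).card := by exact_mod_cast (hne n).card_pos
  have hb := abs_sum_sub_sum_le (Finset.card_image_of_injective (Φ n) he).symm (hu n)
  rw [Finset.sum_image he.injOn] at hb
  rw [Finset.expect_eq_sum_div_card, Finset.expect_eq_sum_div_card, ← sub_div, Real.norm_eq_abs,
    abs_div, abs_of_pos hpos, div_le_iff₀ hpos]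
  refine hb.trans_eq ?_
  field_simp

lemma IsTwoSidedFolner.isAsympInvariant [Group Γ] [DecidableEq Γ] {Φ : ℕ → Finset Γ}
    (hΦ : IsTwoSidedFolner Φ) (a b : Γ) : IsAsympInvariant Φ fun g => a * g * b :=
  (isAsympInvariant_of_tendsto hΦ.1.1 (mul_left_injective b) (hΦ.2 b)).comp
    (isAsympInvariant_of_tendsto hΦ.1.1 (mul_right_injective a) (hΦ.1.2 a))

lemma abs_expect_le_of_abs_le_s6 {s : Finset Γ} (hs : s.Nonempty) {u : Γ → ℝ} {r ε : ℝ}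
    (h : ∀ g, |u g - r| ≤ ε) : |𝔼 g ∈ s, u g - r| ≤ ε := by
  rw [← Finset.expect_const hs r, ← Finset.expect_sub_distrib]
  exact (Finset.abs_expect_le _ _).trans (Finset.expect_le hs fun g _ => by simpa using h g)

lemma tendsto_expect_expect_sub {Φ Ψ : ℕ → Finset Γ} (hΦ : ∀ n, (Φ n).Nonempty)
    (hΨ : ∀ n, (Ψ n).Nonempty) {e e' : Γ → Γ} (he : IsAsympInvariant Φ e)
    (he' : IsAsympInvariant Ψ e') {C : ℝ} {a : Γ → Γ → ℝ} (ha : ∀ g h, |a g h| ≤ C) :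
    Tendsto (fun n => 𝔼 g ∈ Φ n, 𝔼 h ∈ Ψ n, a (e g) (e' h) - 𝔼 g ∈ Φ n, 𝔼 h ∈ Ψ n, a g h)
      atTop (nhds 0) := by
  have h1 := he C (fun n g => 𝔼 h ∈ Ψ n, a g (e' h)) fun n g => by
    simpa using abs_expect_le_of_abs_le_s6 (hΨ n) (r := 0) fun h => by simpa using ha g (e' h)
  have h2 := he' C (fun n h => 𝔼 g ∈ Φ n, a g h) fun n h => by
    simpa using abs_expect_le_of_abs_le_s6 (hΦ n) (r := 0) fun g => by simpa using ha g h
  have h3 := h1.add h2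
  simp only [add_zero] at h3
  refine h3.congr fun n => ?_
  rw [Finset.expect_comm (Ψ n), Finset.expect_comm (Ψ n)]
  ring

end Folner

section Convergence

variable {G : Type*} [Group G]

lemma abs_quadForm_translate_sub_le {c : G → G → G → G → ℝ}
    (hl : ∀ k k' j j', c k k' j j' = c k' k j j') (hr : ∀ k k' j j', c k k' j j' = c k k' j' j)
    (invl : ∀ g k k' j j', c (k * g) (k' * g) j j' = c k k' j j')
    (invr : ∀ h k k' j j', c k k' (j * h) (j' * h) = c k k' j j')
    (psdl : ∀ v, ∀ q ∈ probWeights G, 0 ≤ quadForm c v v q q)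
    (psdr : ∀ p ∈ probWeights G, ∀ v, 0 ≤ quadForm c p p v v)
    {L ε : ℝ} (hL : ∀ p ∈ probWeights G, ∀ q ∈ probWeights G, L ≤ quadForm c p p q q)
    {p q : G →₀ ℝ} (hp : p ∈ probWeights G) (hq : q ∈ probWeights G)
    (hε : quadForm c p p q q ≤ L + ε) (g h : G) :
    |quadForm c p (p.mapDomain (· * g)) q (q.mapDomain (· * h)) - L| ≤ 5 * ε := by
  set p' := p.mapDomain (· * g)
  set q' := q.mapDomain (· * h)
  have hpm : p' ∈ probWeights G := mapDomain_mem_probWeights hp _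
  have hqm : q' ∈ probWeights G := mapDomain_mem_probWeights hq _
  have el (r : G →₀ ℝ) : quadForm c p' p' r r = quadForm c p p r r := by
    have := quadForm_mapDomain c (· * g) (· * g) id id p p r r
    simpa only [Finsupp.mapDomain_id, invl, id] using this
  have er (r : G →₀ ℝ) : quadForm c r r q' q' = quadForm c r r q q := by
    have := quadForm_mapDomain c id id (· * h) (· * h) r r q q
    simpa only [Finsupp.mapDomain_id, invr, id] using this
  have hm := midpoint_mem_probWeights hp hpm
  have hn := midpoint_mem_probWeights hq hqm
  have key := polarization_of_symm (quadForm c) (quadForm_symm_left hl) (quadForm_symm_right hr)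
    (rfl : (1 / 2 : ℝ) • (p + p') = _) (rfl : (1 / 2 : ℝ) • (q + q') = _)
  set m := (1 / 2 : ℝ) • (p + p')
  set n := (1 / 2 : ℝ) • (q + q')
  have cl (r : G →₀ ℝ) (hr' : r ∈ probWeights G) :
      quadForm c m m r r ≤ quadForm c p p r r := by
    have := midpoint_le_of_nonneg (((quadForm c).compr₂ (LinearMap.applyₗ r)).compr₂
      (LinearMap.applyₗ r)) p p' (psdl _ r hr')
    simp only [LinearMap.compr₂_apply, LinearMap.applyₗ_apply_apply] at this
    rw [el, add_self_div_two] at this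
    exact this
  have cr (r : G →₀ ℝ) (hr' : r ∈ probWeights G) :
      quadForm c r r n n ≤ quadForm c r r q q := by
    have := midpoint_le_of_nonneg (quadForm c r r) q q' (psdr r hr' _)
    rw [er, add_self_div_two] at this
    exact this
  simp only [el, er] at key
  have h1 := cl q hq
  have h2 := cr p hp
  have h3 := cl n hn
  have h4 := hL m hm n hn
  have h5 := hL m hm q hq
  have h6 := hL p hp n hn
  have h7 := hL p hp q hq
  rw [key, abs_le]
  constructor <;> linarith

lemma exists_tendsto_expect_expect_kernel [DecidableEq G] {c : G → G → G → G → ℝ}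
    (hl : ∀ k k' j j', c k k' j j' = c k' k j j') (hr : ∀ k k' j j', c k k' j j' = c k k' j' j)
    (invl : ∀ g k k' j j', c (k * g) (k' * g) j j' = c k k' j j')
    (invr : ∀ h k k' j j', c k k' (j * h) (j' * h) = c k k' j j')
    (psdl : ∀ v, ∀ q ∈ probWeights G, 0 ≤ quadForm c v v q q)
    (psdr : ∀ p ∈ probWeights G, ∀ v, 0 ≤ quadForm c p p v v)
    {m C : ℝ} (hm : ∀ p ∈ probWeights G, ∀ q ∈ probWeights G, m ≤ quadForm c p p q q)
    (hC : ∀ k k' j j', |c k k' j j'| ≤ C)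
    {Φ Ψ : ℕ → Finset G} (hΦ : IsTwoSidedFolner Φ) (hΨ : IsTwoSidedFolner Ψ) :
    ∃ L : ℝ, m ≤ L ∧
      Tendsto (fun n => 𝔼 g ∈ Φ n, 𝔼 h ∈ Ψ n, c 1 g 1 h) atTop (nhds L) := by
  set s : Set ℝ := {r | ∃ p ∈ probWeights G, ∃ q ∈ probWeights G, quadForm c p p q q = r}
  have hne : s.Nonempty :=
    ⟨_, _, single_mem_probWeights 1, _, single_mem_probWeights 1, rfl⟩
  have hlow : ∀ r ∈ s, m ≤ r := by
    rintro _ ⟨p, hp, q, hq, rfl⟩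
    exact hm p hp q hq
  have hL : ∀ p ∈ probWeights G, ∀ q ∈ probWeights G, sInf s ≤ quadForm c p p q q :=
    fun p hp q hq => csInf_le ⟨m, hlow⟩ ⟨p, hp, q, hq, rfl⟩
  refine ⟨sInf s, le_csInf hne hlow, ?_⟩
  rw [Metric.tendsto_nhds]
  intro δ hδ
  obtain ⟨_, ⟨p, hp, q, hq, rfl⟩, hlt⟩ :=
    exists_lt_of_csInf_lt hne (lt_add_of_pos_right (sInf s) (by positivity : 0 < δ / 10))
  have hb := abs_quadForm_translate_sub_le hl hr invl invr psdl psdr hL hp hq hlt.le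
  have htr (k k' j j' g h : G) : c k (k' * g) j (j' * h) = c 1 (k' * g * k⁻¹) 1 (j' * h * j⁻¹) := by
    have h1 := invl k 1 (k' * g * k⁻¹) j (j' * h)
    have h2 := invr j 1 (k' * g * k⁻¹) 1 (j' * h * j⁻¹)
    rw [one_mul, inv_mul_cancel_right] at h1 h2
    rw [h1, h2]
  have hz := tendsto_quadForm_zero (c := fun n k k' j j' =>
    (𝔼 g ∈ Φ n, 𝔼 h ∈ Ψ n, c k (k' * g) j (j' * h)) - 𝔼 g ∈ Φ n, 𝔼 h ∈ Ψ n, c 1 g 1 h)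
    (fun k k' j j' => by
      simpa only [← htr] using tendsto_expect_expect_sub hΦ.1.1 hΨ.1.1 (hΦ.isAsympInvariant k' k⁻¹)
        (hΨ.isAsympInvariant j' j⁻¹) (a := fun g h => c 1 g 1 h) fun g h => hC _ _ _ _)
    p p q q
  filter_upwards [Metric.tendsto_nhds.1 hz (δ / 2) (by positivity)] with n hn
  rw [quadForm_sub, quadForm_const _ hp hp hq hq, quadForm_expect, Real.dist_eq, sub_zero] at hn
  have havg : |𝔼 g ∈ Φ n, quadForm (fun k k' j j' => 𝔼 h ∈ Ψ n, c k (k' * g) j (j' * h))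
      p p q q - sInf s| ≤ 5 * (δ / 10) :=
    abs_expect_le_of_abs_le_s6 (hΦ.1.1 n) fun g => by
      rw [quadForm_expect]
      refine abs_expect_le_of_abs_le_s6 (hΨ.1.1 n) fun h => ?_
      have := quadForm_mapDomain c id (· * g) id (· * h) p p q q
      simp only [Finsupp.mapDomain_id, id] at this
      rw [← this]
      exact hb g h
  rw [Real.dist_eq]
  rw [abs_lt] at hn ⊢
  rw [abs_le] at havg
  constructor <;> linarith [hn.1, hn.2, havg.1, havg.2]

end Convergence

section Action

variable {X : Type*} [MeasurableSpace X] {μ : Measure X}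

lemma ae_eq_self_of_idempotent [StandardBorelSpace X] [IsFiniteMeasure μ] {τ : X → X}
    (hτ : MeasurePreserving τ μ μ) (hid : ∀ x, τ (τ x) = τ x) : ∀ᵐ x ∂μ, τ x = x := by
  have hs : MeasurableSet {x | τ x = x} := measurableSet_eq_fun hτ.measurable measurable_id
  rw [ae_iff, ← Set.compl_ofPred, measure_compl hs (measure_ne_top _ _),
    ← hτ.measure_preimage hs.nullMeasurableSet]
  simp [hid]

lemma integral_comp_of_measurePreserving {τ : X → X} (hτ : MeasurePreserving τ μ μ) {g : X → ℝ}
    (hg : Measurable g) : ∫ x, g (τ x) ∂μ = ∫ x, g x ∂μ := by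
  conv_rhs => rw [← hτ.map_eq]
  exact (integral_map hτ.aemeasurable hg.aestronglyMeasurable).symm

lemma pow_four_integral_le [IsProbabilityMeasure μ] {g : X → ℝ} (hg : Integrable g μ)
    (hg4 : Integrable (fun x => g x ^ 4) μ) : (∫ x, g x ∂μ) ^ 4 ≤ ∫ x, g x ^ 4 ∂μ :=
  (Even.convexOn_pow (by decide : Even 4)).map_integral_le (by fun_prop) isClosed_univ
    (by simp) hg hg4

lemma rectKernel_abs_le {ι κ : Type*} {M : ι → κ → ℝ} {C : ℝ} (hM : ∀ k j, |M k j| ≤ C)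
    (k k' : ι) (j j' : κ) : |rectKernel M k k' j j'| ≤ C * C * C * C := by
  have hC : 0 ≤ C := (abs_nonneg _).trans (hM k j)
  rw [rectKernel, abs_mul, abs_mul, abs_mul]
  gcongr <;> apply hM

end Action

/-- Corollary 1.5. For commuting measure-preserving actions `T, S` of a
countable group on a standard probability space and a nonnegative `f ∈ L^∞(μ)`, the limit
`lim (1/(|Φₙ||Ψₙ|)) Σ_{(g,h)} ∫ f·(f∘T_g)·(f∘S_h)·(f∘T_g∘S_h) dμ` exists and is at least
`(∫ f dμ)⁴`, for all two-sided Følner sequences `Φ, Ψ`. -/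
theorem khintchine_recurrence_two_actions
    {G : Type*} [Group G] [Countable G] [DecidableEq G]
    {X : Type*} [MeasurableSpace X] [StandardBorelSpace X]
    (μ : Measure X) [IsProbabilityMeasure μ]
    (T S : G → X → X)
    (hTm : ∀ g, MeasurePreserving (T g) μ μ)
    (hSm : ∀ g, MeasurePreserving (S g) μ μ)
    (hTact : ∀ g h x, T (g * h) x = T g (T h x))
    (hSact : ∀ g h x, S (g * h) x = S g (S h x))
    (hcomm : ∀ g h x, T g (S h x) = S h (T g x))
    (f : X → ℝ) (hfm : Measurable f) (hfb : ∃ C : ℝ, ∀ x, |f x| ≤ C)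
    (hf0 : ∀ x, 0 ≤ f x) :
    ∀ Φ Ψ : ℕ → Finset G, IsTwoSidedFolner Φ → IsTwoSidedFolner Ψ →
      ∃ L : ℝ, (∫ x, f x ∂μ) ^ 4 ≤ L ∧
        Tendsto (fun n =>
          (1 / (((Φ n).card : ℝ) * ((Ψ n).card : ℝ))) *
            ∑ g ∈ Φ n, ∑ h ∈ Ψ n,
              ∫ x, f x * f (T g x) * f (S h x) * f (T g (S h x)) ∂μ)
          atTop (nhds L) := by
  intro Φ Ψ hΦ hΨ
  obtain ⟨C, hC⟩ := hfb
  set F : X → G → G → ℝ := fun x k j => f (T k (S j x)) with hF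
  have hFm (k j : G) : Measurable fun x => F x k j :=
    hfm.comp ((hTm k).measurable.comp (hSm j).measurable)
  have hFi (k j : G) : Integrable (fun x => F x k j) μ :=
    .of_bound (hFm k j).aestronglyMeasurable C (.of_forall fun x => hC _)
  have hFint (k j : G) : ∫ x, F x k j ∂μ = ∫ x, f x ∂μ :=
    integral_comp_of_measurePreserving ((hTm k).comp (hSm j)) hfm
  have hK (x : X) (k k' j j' : G) : |rectKernel (F x) k k' j j'| ≤ C * C * C * C :=
    rectKernel_abs_le (fun _ _ => hC _) k k' j j'
  have hKm (k k' j j' : G) : Measurable fun x => rectKernel (F x) k k' j j' :=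
    (((hFm k j).mul (hFm k' j)).mul (hFm k j')).mul (hFm k' j')
  have hKi (k k' j j' : G) : Integrable (fun x => rectKernel (F x) k k' j j') μ :=
    .of_bound (hKm k k' j j').aestronglyMeasurable (C * C * C * C)
      (.of_forall fun x => hK x _ _ _ _)
  obtain ⟨L, hL, hlim⟩ := exists_tendsto_expect_expect_kernel
    (c := fun k k' j j' => ∫ x, rectKernel (F x) k k' j j' ∂μ) (m := (∫ x, f x ∂μ) ^ 4)
    (C := C * C * C * C)
    (fun k k' j j' => by
      congr 1 with x
      simp only [rectKernel]
      ring)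
    (fun k k' j j' => by
      congr 1 with x
      simp only [rectKernel]
      ring)
    (fun g k k' j j' => by
      rw [← integral_comp_of_measurePreserving (hTm g) (hKm k k' j j')]
      simp only [rectKernel, hF, hTact, hcomm])
    (fun h k k' j j' => by
      rw [← integral_comp_of_measurePreserving (hSm h) (hKm k k' j j')]
      simp only [rectKernel, hF, hSact])
    (fun v q hq => by
      rw [quadForm_integral hKi]
      exact integral_nonneg fun x => quadForm_rectKernel_nonneg _ v hq.1)
    (fun p hp v => by
      rw [quadForm_integral hKi]
      refine integral_nonneg fun x => ?_
      rw [quadForm_rectKernel_swap]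
      exact quadForm_rectKernel_nonneg _ v hp.1)
    (fun p hp q hq => by
      set A : X → ℝ := fun x => ∑ k ∈ p.support, p k * ∑ j ∈ q.support, q j * F x k j with hA
      have hAm : Measurable A := by fun_prop
      have hAi : Integrable A μ := integrable_finsetSum _ fun k _ =>
        (integrable_finsetSum _ fun j _ => (hFi k j).const_mul _).const_mul _
      have hle (x : X) : A x ^ 4 ≤ quadForm (rectKernel (F x)) p p q q :=
        pow_four_le_quadForm_rectKernel _ hp hq
      have hQi := integrable_quadForm hKi p p q q
      have hA4 : Integrable (fun x => A x ^ 4) μ :=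
        hQi.mono' (hAm.pow_const 4).aestronglyMeasurable <| .of_forall fun x => by
          rw [Real.norm_eq_abs, abs_of_nonneg (by positivity)]
          exact hle x
      have hAint : ∫ x, A x ∂μ = ∫ x, f x ∂μ := by
        rw [hA, integral_finsetSum _ fun k _ =>
          (integrable_finsetSum _ fun j _ => (hFi k j).const_mul _).const_mul _]
        have hrow (k : G) : ∫ x, ∑ j ∈ q.support, q j * F x k j ∂μ = ∫ x, f x ∂μ := by
          rw [integral_finsetSum _ fun j _ => (hFi k j).const_mul _]
          simp_rw [integral_const_mul, hFint]
          rw [← Finset.sum_mul, hq.2, one_mul]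
        simp_rw [integral_const_mul, hrow]
        rw [← Finset.sum_mul, hp.2, one_mul]
      rw [quadForm_integral hKi, ← hAint]
      exact (pow_four_integral_le hAi hA4).trans (integral_mono hA4 hQi hle))
    (fun k k' j j' => by
      simpa using norm_integral_le_of_norm_le_const (μ := μ)
        (.of_forall fun x => (Real.norm_eq_abs _).trans_le (hK x k k' j j')))
    hΦ hΨ
  refine ⟨L, hL, hlim.congr fun n => ?_⟩
  have hT1 := ae_eq_self_of_idempotent (hTm 1) fun x => by rw [← hTact, one_mul]
  have hS1 := ae_eq_self_of_idempotent (hSm 1) fun x => by rw [← hSact, one_mul]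
  have hval (g h : G) : ∫ x, rectKernel (F x) 1 g 1 h ∂μ =
      ∫ x, f x * f (T g x) * f (S h x) * f (T g (S h x)) ∂μ := by
    refine integral_congr_ae ?_
    filter_upwards [hT1, hS1] with x hx hx'
    simp only [rectKernel, hF, hx', hcomm 1, hx]
  simp only [hval, Finset.expect_eq_sum_div_card, ← Finset.sum_div]
  rw [div_div, one_div, inv_mul_eq_div, mul_comm ((Ψ n).card : ℝ)]
end
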